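/- arXiv:2508.12348 — 2 statements merged into one kernel-verified Lean document; each statement's English description precedes it below -/
import Mathlib

section
/- For every n ∈ ℕ and every δ with 0 < δ < δ_{n+1} (where δ_k := k⁻¹·2^{−2k−1}) there exists S₁ > 1 such that: if X is an S-concave, (C,D)-locally semi-convex, Busemann concave complete geodesic space with S ∈ [1, S₁] and Hausdorff dimension n, then, setting A(0,δ) := X, X_n := A(n,δ), and X_k := A(k,δ) \ A(k+1,δ) for k = 0, …, n−1, the sets X_0, …, X_n are pairwise disjoint, their union is X, and dimH(X_k) ≤ k for every k = 0, …, n. -/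
open Set Metric MeasureTheory Filter Topology

noncomputable section

variable {X : Type*} [MetricSpace X]

/-- A constant-speed geodesic parametrized on `[0,1]`. -/
def IsConstSpeedGeodesic (γ : ℝ → X) : Prop :=
  ∀ s ∈ Set.Icc (0:ℝ) 1, ∀ t ∈ Set.Icc (0:ℝ) 1,
    dist (γ s) (γ t) = |s - t| * dist (γ 0) (γ 1)

/-- A unit-speed geodesic parametrized on `[a,b]`. -/
def IsUnitSpeedGeodesicOn (ξ : ℝ → X) (a b : ℝ) : Prop :=
  ∀ s ∈ Set.Icc a b, ∀ t ∈ Set.Icc a b, dist (ξ s) (ξ t) = |s - t|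

/-- A geodesic space: any two points are joined by a constant-speed geodesic. -/
def IsGeodesicSpace (X : Type*) [MetricSpace X] : Prop :=
  ∀ x y : X, ∃ γ : ℝ → X, IsConstSpeedGeodesic γ ∧ γ 0 = x ∧ γ 1 = y

/-- `S`-concavity of the squared distance functions. -/
def SConcave (X : Type*) [MetricSpace X] (S : ℝ) : Prop :=
  ∀ (p : X) (γ : ℝ → X), IsConstSpeedGeodesic γ → ∀ t ∈ Set.Icc (0:ℝ) 1,
    (1 - t) * dist p (γ 0) ^ 2 + t * dist p (γ 1) ^ 2
      - S * t * (1 - t) * dist (γ 0) (γ 1) ^ 2 ≤ dist p (γ t) ^ 2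

/-- `(C,D)`-local semi-convexity of the squared distance functions. -/
def LocSemiConvex (X : Type*) [MetricSpace X] (C D : ℝ) : Prop :=
  ∀ (p : X) (γ : ℝ → X), IsConstSpeedGeodesic γ →
    (∀ t ∈ Set.Icc (0:ℝ) 1, dist p (γ t) < D) →
    ∀ t ∈ Set.Icc (0:ℝ) 1,
      dist p (γ t) ^ 2 ≤ (1 - t) * dist p (γ 0) ^ 2 + t * dist p (γ 1) ^ 2
        + C * t * (1 - t) * dist (γ 0) (γ 1) ^ 2

/-- Busemann concavity: `t ↦ dist (γ t) (η t) / t` is non-increasing for geodesics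
with a common starting point. -/
def BusemannConcave (X : Type*) [MetricSpace X] : Prop :=
  ∀ γ η : ℝ → X, IsConstSpeedGeodesic γ → IsConstSpeedGeodesic η → γ 0 = η 0 →
    ∀ s t : ℝ, 0 < s → s ≤ t → t ≤ 1 →
      dist (γ t) (η t) / t ≤ dist (γ s) (η s) / s

/-- The Euclidean comparison angle `∠̃(p, x, q)` at the vertex `x`. -/
def compAngle (p x q : X) : ℝ :=
  Real.arccos ((dist x p ^ 2 + dist x q ^ 2 - dist p q ^ 2) / (2 * dist x p * dist x q))

/-- `p` is a `(1,δ)`-strainer at `x` with opposite strainer `q`. -/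
def IsOneStrainer (S δ : ℝ) (x p q : X) : Prop :=
  p ≠ x ∧ q ≠ x ∧ Real.pi - δ < compAngle p x q ∧
    Real.arccos (1 - S * dist q x / (2 * dist p x)) < δ

/-- The tuple `p` is a `(k,δ)`-strainer at `x` with opposite strainer `q`. -/
def IsStrainer (S C D δ : ℝ) (x : X) {k : ℕ} (p q : Fin k → X) : Prop :=
  (∀ j, IsOneStrainer S δ x (p j) (q j)) ∧
  (∀ j : Fin k, (j : ℕ) = 0 → dist (p j) x < D) ∧
  ∀ i j : Fin k, i < j →
    Real.arccos (1 - (S + C) * dist (p j) x / (2 * dist (p i) x)) < δ ∧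
    |compAngle (p i) x (p j) - Real.pi / 2| < δ ∧
    |compAngle (p i) x (q j) - Real.pi / 2| < δ

/-- The set `A(k,δ)` of `(k,δ)`-strained points. -/
def strainedPoints (X : Type*) [MetricSpace X] (S C D δ : ℝ) (k : ℕ) : Set X :=
  {x : X | ∃ p q : Fin k → X, IsStrainer S C D δ x p q}

/-- The constant `δ_k = k⁻¹ 2^{-2k-1}`. -/
def strainerDelta (k : ℕ) : ℝ := ((k : ℝ) * 2 ^ (2 * k + 1))⁻¹

/-- The `ℓ¹` distance on `Fin k → ℝ`. -/
def l1dist {k : ℕ} (u v : Fin k → ℝ) : ℝ := ∑ i, |u i - v i|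

/-- `F` is an `ε`-open map on `U`, where the target carries the distance `dY`. -/
def IsEpsOpenOn {Y : Type*} (F : X → Y) (dY : Y → Y → ℝ) (U : Set X) (ε : ℝ) : Prop :=
  ∀ x ∈ U, ∃ r > 0, Metric.closedBall x (ε⁻¹ * r) ⊆ U ∧
    IsComplete (Metric.closedBall x (ε⁻¹ * r)) ∧
    ∀ v : Y, dY (F x) v < r → ∃ y ∈ U, F y = v ∧ ε * dist x y ≤ dY (F x) v

/-- `N` is a norm on a real vector space. -/
def IsNormFn {E : Type*} [AddCommGroup E] [Module ℝ E] (N : E → ℝ) : Prop :=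
  (∀ u, 0 ≤ N u) ∧ (∀ u, N u = 0 ↔ u = 0) ∧
  (∀ (a : ℝ) (u : E), N (a • u) = |a| * N u) ∧ ∀ u v, N (u + v) ≤ N u + N v

/-- `F` is an `ε`-isometry between pointed metric spaces, the metrics being
given by the explicit distance functions `dX` and `dY`. -/
def IsEpsIsometry {Y : Type*} (dX : X → X → ℝ) (x : X) (dY : Y → Y → ℝ) (y : Y)
    (ε : ℝ) (F : X → Y) : Prop :=
  F x = y ∧
  (∀ z z' : X, dX x z < 1 / ε → dX x z' < 1 / ε →
    |dX z z' - dY (F z) (F z')| < ε) ∧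
  ∀ r : ℝ, r < 1 / ε → ∀ w : Y, dY y w < r - ε →
    ∃ z : X, dX x z < r ∧ dY w (F z) ≤ ε

/-- The metric space `X` is doubling with constant `N`. -/
def MetricDoubling (X : Type*) [MetricSpace X] (N : ℕ) : Prop :=
  ∀ (x : X) (r : ℝ), 0 < r → ∃ t : Finset X,
    (Metric.ball x r ⊆ ⋃ y ∈ t, Metric.ball y (r / 2)) ∧ t.card ≤ N

/-- A metric space with a uniform branching property on a ball has large Hausdorff dimension. -/
theorem aux_cantor {X : Type*} [MetricSpace X] [CompleteSpace X] (o : X) (r η κ : ℝ) (hr : 0 < r)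
    (hη : 0 < η) (hη1 : η ≤ 1) (hκ : κ = η / 8) (M d : ℕ) (hM : 1 < M) (hd : 0 < d)
    (hMd : 1 ≤ (M : ℝ) * κ ^ d)
    (H : ∀ y : X, dist y o ≤ r → ∀ ρ : ℝ, 0 < ρ → ρ ≤ r → ∃ u : Fin M → X,
      (∀ i, dist (u i) y ≤ ρ) ∧ ∀ i j, i ≠ j → η * ρ ≤ dist (u i) (u j)) :
    (d : ENNReal) ≤ dimH (Set.univ : Set X) := by
  have : Nonempty X := ⟨o⟩
  choose! u hu1 hu2 using H
  have hκ0 : 0 < κ := by rw [hκ]; positivity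
  have hκ1 : κ ≤ 1 / 8 := by rw [hκ]; linarith
  let Y : (ℕ → Fin M) → ℕ → X := fun a m => Nat.rec o (fun l y => u y (r / 2 * κ ^ l) (a l)) m
  have hY0 : ∀ a, Y a 0 = o := fun a => rfl
  have hYs : ∀ a m, Y a (m + 1) = u (Y a m) (r / 2 * κ ^ m) (a m) := fun a m => rfl
  have hρ0 : ∀ m, 0 < r / 2 * κ ^ m := fun m => by positivity
  have hκm : ∀ m : ℕ, κ ^ m ≤ 1 := fun m => pow_le_one₀ hκ0.le (by linarith)
  have hρ1 : ∀ m, r / 2 * κ ^ m ≤ r := fun m => by nlinarith [hκm m]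
  have hball : ∀ a m, dist (Y a m) o ≤ r * (1 - κ ^ m) := by
    intro a m
    induction m with
    | zero => simp [hY0]
    | succ m ih =>
      have h1 : dist (Y a m) o ≤ r := by
        have : 0 < r * κ ^ m := by positivity
        linarith
      have h2 := hu1 (Y a m) h1 _ (hρ0 m) (hρ1 m) (a m)
      rw [← hYs] at h2
      have h3 := dist_triangle (Y a (m + 1)) (Y a m) o
      have h4 : 0 < r * κ ^ m := by positivity
      rw [pow_succ]
      nlinarith
  have hball' : ∀ a m, dist (Y a m) o ≤ r := by
    intro a m
    have := hball a m
    have : 0 < r * κ ^ m := by positivity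
    linarith
  have hstep : ∀ a m, dist (Y a m) (Y a (m + 1)) ≤ r / 2 * κ ^ m := by
    intro a m
    rw [dist_comm, hYs]
    exact hu1 _ (hball' a m) _ (hρ0 m) (hρ1 m) _
  have hκlt : κ < 1 := by linarith
  have hlim : ∀ a, ∃ x, Tendsto (Y a) atTop (𝓝 x) := fun a =>
    cauchySeq_tendsto_of_complete (cauchySeq_of_le_geometric κ (r / 2) hκlt (hstep a))
  choose φ hφ using hlim
  have hφd : ∀ a m, dist (Y a m) (φ a) ≤ r * κ ^ m := by
    intro a m
    refine (dist_le_of_le_geometric_of_tendsto κ (r / 2) hκlt (hstep a) (hφ a) m).trans ?_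
    rw [div_le_iff₀ (by linarith)]
    have : 0 < r * κ ^ m := by positivity
    nlinarith
  have hagree : ∀ a b m, (∀ i < m, a i = b i) → Y a m = Y b m := by
    intro a b m
    induction m with
    | zero => intro _; rfl
    | succ m ih =>
      intro h
      rw [hYs, hYs, ih (fun i hi => h i (by omega)), h m (by omega)]
  have hsep : ∀ a b m, (∀ i < m, a i = b i) → a m ≠ b m →
      η * r / 4 * κ ^ m ≤ dist (φ a) (φ b) := by
    intro a b m h hne
    have h1 := hu2 (Y a m) (hball' a m) _ (hρ0 m) (hρ1 m) (a m) (b m) hne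
    rw [← hYs, hagree a b m h, ← hYs] at h1
    have h2 := hφd a (m + 1)
    have h3 := hφd b (m + 1)
    have h4 := dist_triangle4 (Y a (m + 1)) (φ a) (φ b) (Y b (m + 1))
    rw [dist_comm (φ b)] at h4
    rw [pow_succ] at h2 h3
    have h5 : r * (κ ^ m * κ) = η * r / 8 * κ ^ m := by rw [hκ]; ring
    linarith
  have hfirst : ∀ a b : ℕ → Fin M, a ≠ b → ∃ m, (∀ i < m, a i = b i) ∧ a m ≠ b m := by
    intro a b h
    have : ∃ m, a m ≠ b m := by
      by_contra! h'
      exact h (funext h')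
    classical
    refine ⟨Nat.find this, fun i hi => ?_, Nat.find_spec this⟩
    have := Nat.find_min this hi
    simpa using this
  have hinj : Function.Injective φ := by
    intro a b hab
    by_contra hne
    obtain ⟨m, h1, h2⟩ := hfirst a b hne
    have := hsep a b m h1 h2
    rw [hab, dist_self] at this
    have : 0 < η * r / 4 * κ ^ m := by positivity
    linarith
  have : Nonempty (ℕ → Fin M) := ⟨fun _ => ⟨0, by omega⟩⟩
  let f : X → ℝ := fun x => Real.ofDigits (Function.invFun φ x)
  have hf : ∀ a, f (φ a) = Real.ofDigits a := fun a => by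
    simp only [f, Function.leftInverse_invFun hinj a]
  have hc : 0 < η * r / 4 := by positivity
  have hmain : ∀ a b, dist (f (φ a)) (f (φ b)) ≤
      ((η * r / 4)⁻¹) ^ d * dist (φ a) (φ b) ^ d := by
    intro a b
    rw [hf, hf]
    by_cases hab : a = b
    · subst hab; simp [hd.ne']
    obtain ⟨m, h1, h2⟩ := hfirst a b hab
    have h3 := hsep a b m h1 h2
    have h4 := Real.abs_ofDigits_sub_ofDigits_le h1
    rw [Real.dist_eq]
    refine h4.trans ?_
    rw [← mul_pow]
    have h5 : κ ^ m ≤ (η * r / 4)⁻¹ * dist (φ a) (φ b) := by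
      rw [inv_mul_eq_div, le_div_iff₀ hc]; linarith
    refine le_trans ?_ (pow_le_pow_left₀ (by positivity) h5 d)
    have h6 : (1 : ℝ) ≤ ((M : ℝ) * κ ^ d) ^ m := one_le_pow₀ hMd
    rw [mul_pow, ← pow_mul, mul_comm d m, pow_mul] at h6
    have hMpos : (0 : ℝ) < (M : ℝ) ^ m := by positivity
    rw [inv_eq_one_div, div_le_iff₀ hMpos]
    linarith
  have hholder : HolderOnWith (Real.toNNReal (((η * r / 4)⁻¹) ^ d)) (d : NNReal) f (Set.range φ) := by
    rintro _ ⟨a, rfl⟩ _ ⟨b, rfl⟩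
    have := hmain a b
    rw [edist_dist, edist_dist]
    have h2 : ENNReal.ofReal (dist (φ a) (φ b)) ^ (((d : NNReal) : ℝ)) =
        ENNReal.ofReal (dist (φ a) (φ b) ^ d) := by
      rw [NNReal.coe_natCast, ENNReal.rpow_natCast, ENNReal.ofReal_pow dist_nonneg]
    rw [h2, ← ENNReal.ofReal.eq_1, ← ENNReal.ofReal_mul (by positivity)]
    exact ENNReal.ofReal_le_ofReal this
  have himg : Set.Icc (0 : ℝ) 1 ⊆ f '' Set.range φ := by
    intro y hy
    obtain ⟨a, -, ha⟩ := Real.ofDigits_SurjOn hM hy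
    exact ⟨φ a, ⟨a, rfl⟩, by rw [hf, ha]⟩
  have hdim := hholder.dimH_image_le (by exact_mod_cast hd)
  have h1 : (1 : ENNReal) ≤ dimH (f '' Set.range φ) := by
    refine le_trans ?_ (dimH_mono himg)
    rw [Real.dimH_of_nonempty_interior (by simp)]
    simp
  have h2 := h1.trans (hdim.trans (ENNReal.div_le_div_right (dimH_mono (Set.subset_univ _)) _))
  rw [ENNReal.le_div_iff_mul_le (by left; simpa using hd.ne') (by left; simp)] at h2
  simpa using h2

/-- Restricting a constant-speed geodesic to an initial segment. -/
theorem aux_geod_restrict {X : Type*} [MetricSpace X] {γ : ℝ → X} (h : IsConstSpeedGeodesic γ)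
    {c : ℝ} (hc0 : 0 ≤ c) (hc1 : c ≤ 1) : IsConstSpeedGeodesic (fun t => γ (t * c)) := by
  intro s hs t ht
  have hm : ∀ t ∈ Set.Icc (0:ℝ) 1, t * c ∈ Set.Icc (0:ℝ) 1 := fun t ht =>
    ⟨mul_nonneg ht.1 hc0, by nlinarith [ht.1, ht.2]⟩
  have h1 := h _ (hm s hs) _ (hm t ht)
  have h2 := h _ (hm 0 (by simp)) _ (hm 1 (by simp))
  simp only [h1, h2]
  rw [← sub_mul, abs_mul, ← sub_mul, abs_mul]
  simp
  ring

/-- Uniform packing bound. -/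
theorem aux_packing {X : Type*} [MetricSpace X] [CompleteSpace X] (hG : IsGeodesicSpace X)
    (hB : BusemannConcave X) (n : ℕ) (hn : dimH (Set.univ : Set X) = n) (η : ℝ) (hη : 0 < η) :
    ∃ M : ℕ, ∀ (o : X) (r : ℝ), 0 < r → ∀ w : Fin M → X, (∀ i, dist (w i) o ≤ r) →
      ¬ (∀ i j, i ≠ j → η * r ≤ dist (w i) (w j)) := by
  wlog hη1 : η ≤ 1 generalizing η
  · obtain ⟨M, hM⟩ := this 1 one_pos le_rfl
    refine ⟨M, fun o r hr w hw hsep => hM o r hr w hw fun i j hij => le_trans ?_ (hsep i j hij)⟩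
    nlinarith
  set κ : ℝ := (η / 2) / 8 with hκ
  have hκ0 : 0 < κ := by positivity
  obtain ⟨M, hM⟩ := exists_nat_gt ((κ ^ (n + 1))⁻¹)
  have hM1 : 1 < M := by
    have : (1 : ℝ) ≤ (κ ^ (n + 1))⁻¹ :=
      (one_le_inv₀ (by positivity)).2 (pow_le_one₀ hκ0.le (by rw [hκ]; linarith))
    exact_mod_cast this.trans_lt hM
  refine ⟨M, fun o r hr w hw hsep => ?_⟩
  have key := aux_cantor o r (η / 2) κ hr (by positivity) (by linarith) hκ M (n + 1) hM1
    (Nat.succ_pos n) ?_ ?_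
  · rw [hn] at key
    have : n + 1 ≤ n := by exact_mod_cast key
    omega
  · rw [inv_lt_iff_one_lt_mul₀ (by positivity)] at hM
    linarith
  · intro y hy ρ hρ hρr
    have ht0 : 0 < ρ / (2 * r) := by positivity
    have ht1 : ρ / (2 * r) ≤ 1 := by rw [div_le_one (by positivity)]; linarith
    choose γ hγ hγ0 hγ1 using fun i => hG y (w i)
    refine ⟨fun i => γ i (ρ / (2 * r)), fun i => ?_, fun i j hij => ?_⟩
    · have h1 := hγ i (ρ / (2 * r)) ⟨ht0.le, ht1⟩ 0 (by simp)
      rw [sub_zero, abs_of_pos ht0, hγ0, hγ1] at h1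
      rw [h1]
      have h2 : dist y (w i) ≤ 2 * r := by
        have := dist_triangle y o (w i)
        have := hw i
        rw [dist_comm] at this
        linarith
      calc ρ / (2 * r) * dist y (w i) ≤ ρ / (2 * r) * (2 * r) := by gcongr
        _ = ρ := by field_simp
    · have h1 := hB (γ i) (γ j) (hγ i) (hγ j) (by rw [hγ0, hγ0]) _ 1 ht0 ht1 le_rfl
      rw [hγ1, hγ1, div_one, le_div_iff₀ ht0] at h1
      refine le_trans ?_ h1
      calc η / 2 * ρ = η * r * (ρ / (2 * r)) := by field_simp
        _ ≤ _ := by gcongr; exact hsep i j hij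

theorem aux_secondCountable {X : Type*} [MetricSpace X]
    (hP : ∀ η : ℝ, 0 < η → ∃ M : ℕ, ∀ (o : X) (r : ℝ), 0 < r → ∀ w : Fin M → X,
      (∀ i, dist (w i) o ≤ r) → ¬ (∀ i j, i ≠ j → η * r ≤ dist (w i) (w j))) :
    SecondCountableTopology X := by
  rcases isEmpty_or_nonempty X with hX | ⟨⟨o⟩⟩
  · infer_instance
  refine Metric.secondCountable_of_almost_dense_set fun ε hε => ?_
  obtain ⟨A, hA⟩ := zorn_subset {A : Set X | A.Pairwise fun x y => ε ≤ dist x y} (by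
    intro c hc hchain
    refine ⟨⋃₀ c, ?_, fun s hs => Set.subset_sUnion_of_mem hs⟩
    exact (Set.pairwise_sUnion hchain.directedOn).2 fun s hs => hc hs)
  refine ⟨A, ?_, ?_⟩
  · have hcov : A = ⋃ R : ℕ, A ∩ Metric.closedBall o (R + 1) := by
      ext x
      simp only [Set.mem_iUnion, Set.mem_inter_iff, Metric.mem_closedBall]
      refine ⟨fun h => ?_, fun ⟨_, h, _⟩ => h⟩
      obtain ⟨R, hR⟩ := exists_nat_ge (dist x o)
      exact ⟨R, h, by linarith⟩
    rw [hcov]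
    refine Set.countable_iUnion fun R => Set.Finite.countable ?_
    by_contra hinf
    have hR : (0 : ℝ) < R + 1 := by positivity
    obtain ⟨M, hM⟩ := hP (ε / (R + 1)) (by positivity)
    obtain ⟨t, ht, htc⟩ := Set.Infinite.exists_subset_card_eq hinf M
    let e := t.equivFinOfCardEq htc
    refine hM o (R + 1) hR (fun i => (e.symm i : X)) (fun i => (ht (e.symm i).2).2) ?_
    intro i j hij
    rw [div_mul_cancel₀ _ hR.ne']
    refine hA.1 (ht (e.symm i).2).1 (ht (e.symm j).2).1 ?_
    intro h
    exact hij (e.symm.injective (Subtype.ext h))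
  · intro x
    by_contra! hx
    have hxA : x ∉ A := fun h => by
      have := hx x h
      rw [dist_self] at this
      linarith
    have h1 : insert x A ∈ {A : Set X | A.Pairwise fun x y => ε ≤ dist x y} := by
      refine Set.Pairwise.insert hA.1 fun y hy _ => ⟨(hx y hy).le, ?_⟩
      rw [dist_comm]; exact (hx y hy).le
    exact hxA (hA.2 h1 (Set.subset_insert x A) (Set.mem_insert x A))

/-- The pair `z, z'` is almost horizontal with respect to the distance functions from `p`. -/
def AuxHz {X : Type*} [MetricSpace X] {k : ℕ} (p : Fin k → X) (ε : ℝ) (z z' : X) : Prop :=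
  ∀ a, |dist (p a) z - dist (p a) z'| < ε * dist z z'

theorem aux_noHz_dim {X : Type*} [MetricSpace X] [SecondCountableTopology X] {k : ℕ}
    (p : Fin k → X) (ε ρ : ℝ) (hε : 0 < ε) (hρ : 0 < ρ) (G : Set X)
    (hG : ∀ z ∈ G, ∀ z' ∈ G, z' ≠ z → dist z z' < ρ → ¬ AuxHz p ε z z') :
    dimH G ≤ k := by
  by_contra! hlt
  obtain ⟨x, hx, hx'⟩ := exists_mem_nhdsWithin_lt_dimH_of_lt_dimH hlt
  have h1 := hx' (G ∩ Metric.ball x (ρ / 2))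
    (inter_mem self_mem_nhdsWithin (mem_nhdsWithin_of_mem_nhds (Metric.ball_mem_nhds x (by positivity))))
  set T := G ∩ Metric.ball x (ρ / 2) with hT
  let f : T → (Fin k → ℝ) := fun z a => dist (p a) z
  have hf : AntilipschitzWith (Real.toNNReal ε⁻¹) f := by
    refine AntilipschitzWith.of_le_mul_dist fun z z' => ?_
    rw [Real.coe_toNNReal _ (by positivity)]
    by_cases hzz : z' = z
    · subst hzz; simp
    have hd : dist (z : X) z' < ρ := by
      have h1 := z.2.2
      have h2 := z'.2.2
      rw [Metric.mem_ball] at h1 h2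
      have := dist_triangle_right (z : X) z' x
      linarith
    have h2 := hG z z.2.1 z' z'.2.1 (fun h => hzz (Subtype.ext h)) hd
    unfold AuxHz at h2
    push Not at h2
    obtain ⟨a, ha⟩ := h2
    have h3 : |dist (p a) z - dist (p a) z'| ≤ dist (f z) (f z') := by
      rw [← Real.dist_eq]
      exact dist_le_pi_dist (f z) (f z') a
    rw [inv_mul_eq_div, le_div_iff₀ hε, Subtype.dist_eq]
    linarith
  have h2 := hf.le_dimH_image Set.univ
  have h3 : dimH (f '' Set.univ) ≤ k := by
    rw [← Real.dimH_univ_pi_fin k]; exact dimH_mono (Set.subset_univ _)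
  have h4 := (isometry_subtype_coe (s := T)).dimH_image Set.univ
  rw [Set.image_univ, Subtype.range_coe] at h4
  rw [← h4] at h2
  exact absurd (h2.trans h3) (not_le.2 h1)

theorem aux_derived {X : Type*} [MetricSpace X] [SecondCountableTopology X] {k : ℕ}
    (p : Fin k → X) (ε : ℝ) (hε : 0 < ε) (E : Set X) (hE : (k : ENNReal) < dimH E) :
    (k : ENNReal) < dimH {z ∈ E | ∀ ρ > 0, ∃ z' ∈ E, z' ≠ z ∧ dist z z' < ρ ∧ AuxHz p ε z z'} := by
  set E' := {z ∈ E | ∀ ρ > 0, ∃ z' ∈ E, z' ≠ z ∧ dist z z' < ρ ∧ AuxHz p ε z z'} with hE'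
  by_contra! hle
  let G : ℕ → Set X := fun m => {z ∈ E | ∀ z' ∈ E, z' ≠ z → dist z z' < 1 / ((m : ℝ) + 1) →
    ¬ AuxHz p ε z z'}
  have hcov : E ⊆ E' ∪ ⋃ m, G m := by
    intro z hz
    by_cases h : z ∈ E'
    · exact Or.inl h
    right
    have h2 : ¬ ∀ ρ > 0, ∃ z' ∈ E, z' ≠ z ∧ dist z z' < ρ ∧ AuxHz p ε z z' := fun h' => h ⟨hz, h'⟩
    push Not at h2
    obtain ⟨ρ, hρ, h3⟩ := h2
    obtain ⟨m, hm⟩ := exists_nat_one_div_lt hρ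
    exact Set.mem_iUnion.2 ⟨m, hz, fun z' hz' hne hd => h3 z' hz' hne (hd.trans hm)⟩
  have h1 := dimH_mono hcov
  rw [dimH_union, dimH_iUnion] at h1
  refine absurd hE (not_lt.2 (h1.trans (max_le hle (iSup_le fun m => ?_))))
  exact aux_noHz_dim p ε (1 / ((m : ℝ) + 1)) hε (by positivity) _
    fun z hz z' hz' hne hd => hz.2 z' hz'.1 hne hd

theorem aux_sequence {X : Type*} [MetricSpace X] [SecondCountableTopology X] {k : ℕ}
    (p : Fin k → X) (ε lam : ℝ) (hε : 0 < ε) (hlam : 0 < lam) (N : ℕ) :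
    ∀ E : Set X, (k : ENNReal) < dimH E → ∃ z : ℕ → X, (∀ i ≤ N, z i ∈ E) ∧
      (∀ i j, i < j → j ≤ N → z i ≠ z j ∧ AuxHz p ε (z i) (z j)) ∧
      (∀ i j l, i < j → j < l → l ≤ N → dist (z j) (z l) < lam * dist (z i) (z j)) := by
  induction N with
  | zero =>
    intro E hE
    have hne : E.Nonempty := by
      by_contra h
      rw [Set.not_nonempty_iff_eq_empty] at h
      rw [h, dimH_empty] at hE
      exact absurd hE (by simp)
    obtain ⟨x, hx⟩ := hne
    exact ⟨fun _ => x, fun _ _ => hx, fun i j h1 h2 => by omega, fun i j l h1 h2 h3 => by omega⟩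
  | succ N ih =>
    intro E hE
    obtain ⟨z, hz1, hz2, hz3⟩ := ih _ (aux_derived p ε hε E hE)
    -- open conditions at `z N`
    have hopen : ∀ᶠ w in 𝓝 (z N),
        (∀ i ∈ Set.Iio N, z i ≠ w ∧ ∀ a, |dist (p a) (z i) - dist (p a) w| < ε * dist (z i) w) ∧
        (∀ i ∈ Set.Iio N, ∀ j ∈ Set.Iio (N + 1), i < j →
          dist (z j) w < lam * dist (z i) (z j)) := by
      refine Filter.Eventually.and ?_ ?_
      · refine (Filter.eventually_all_finite (Set.finite_Iio N)).2 fun i hi => ?_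
        obtain ⟨h1, h2⟩ := hz2 i N hi le_rfl
        refine Filter.Eventually.and ?_ (Filter.eventually_all.2 fun a => ?_)
        · filter_upwards [isOpen_ne.mem_nhds (Ne.symm h1)] with w hw using Ne.symm hw
        · have hc : Continuous fun w => |dist (p a) (z i) - dist (p a) w| := by fun_prop
          have hc2 : Continuous fun w => ε * dist (z i) w := by fun_prop
          exact (isOpen_lt hc hc2).mem_nhds (h2 a)
      · refine (Filter.eventually_all_finite (Set.finite_Iio N)).2 fun i hi => ?_
        refine (Filter.eventually_all_finite (Set.finite_Iio (N + 1))).2 fun j hj => ?_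
        by_cases hij : i < j
        · have hc : Continuous fun w => dist (z j) w := by fun_prop
          have h0 : dist (z j) (z N) < lam * dist (z i) (z j) := by
            rcases (Nat.lt_succ_iff.1 hj).lt_or_eq with h | h
            · exact hz3 i j N hij h le_rfl
            · subst h
              rw [dist_self]
              exact mul_pos hlam (dist_pos.2 (hz2 i j hij le_rfl).1)
          filter_upwards [(isOpen_lt hc continuous_const).mem_nhds h0] with w hw _ using hw
        · exact Filter.Eventually.of_forall fun w h => absurd h hij
    obtain ⟨ρ, hρ, hball⟩ := Metric.eventually_nhds_iff.1 hopen
    obtain ⟨w, hwE, hwne, hwd, hwH⟩ := (hz1 N le_rfl).2 ρ hρ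
    obtain ⟨hA, hB⟩ := hball (y := w) (by rw [dist_comm]; exact hwd)
    refine ⟨fun i => if i ≤ N then z i else w, ?_, ?_, ?_⟩
    · intro i hi
      by_cases h : i ≤ N
      · simp only [h, if_true]; exact (hz1 i h).1
      · simp only [h, if_false]; exact hwE
    · intro i j hij hj
      have hi : i ≤ N := by omega
      by_cases h : j ≤ N
      · simp only [h, hi, if_true]; exact hz2 i j hij h
      · simp only [h, hi, if_true, if_false]
        rcases hi.lt_or_eq with h' | h'
        · exact hA i h'
        · rw [h']; exact ⟨Ne.symm hwne, hwH⟩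
    · intro i j l hij hjl hl
      have hi : i ≤ N := by omega
      have hj : j ≤ N := by omega
      by_cases h : l ≤ N
      · simp only [h, hi, hj, if_true]; exact hz3 i j l hij hjl h
      · simp only [h, hi, hj, if_true, if_false]
        exact hB i (show i < N by omega) j (show j < N + 1 by omega) hij

/-- Among many points at rapidly decreasing scales there is an almost straight triple. -/
theorem aux_straight {X : Type*} [MetricSpace X] (hG : IsGeodesicSpace X)
    (hB : BusemannConcave X) (η : ℝ) (N : ℕ) (hN : 0 < N)
    (hM : ∀ (o : X) (r : ℝ), 0 < r → ∀ w : Fin N → X, (∀ i, dist (w i) o ≤ r) →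
      ¬ (∀ i j, i ≠ j → η * r ≤ dist (w i) (w j)))
    (z : ℕ → X) (hne : ∀ i j, i < j → j ≤ N → z i ≠ z j)
    (hz : ∀ i j l, i < j → j < l → l ≤ N → dist (z j) (z l) < (1 / 2) * dist (z i) (z j)) :
    ∃ i j, i < j ∧ j < N ∧
      dist (z i) (z j) + dist (z j) (z N) - η * dist (z j) (z N) ≤ dist (z i) (z N) := by
  by_contra! hcon
  have hrpos : ∀ i < N, 0 < dist (z i) (z N) := fun i hi => dist_pos.2 (hne i N hi le_rfl)
  have hrlt : ∀ i j, i < j → j < N → dist (z j) (z N) < dist (z i) (z N) := by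
    intro i j hij hj
    have h1 := hz i j N hij hj le_rfl
    have h2 := dist_triangle_right (z i) (z j) (z N)
    linarith
  set r := dist (z (N - 1)) (z N) with hr
  have hr0 : 0 < r := hrpos _ (by omega)
  have hrle : ∀ i < N, r ≤ dist (z i) (z N) := by
    intro i hi
    rcases (show i ≤ N - 1 by omega).lt_or_eq with h | h
    · exact (hrlt i (N - 1) h (by omega)).le
    · rw [h]
  choose γ hγ hγ0 hγ1 using fun i => hG (z N) (z i)
  have hlen : ∀ i, ∀ t ∈ Set.Icc (0:ℝ) 1, dist (γ i t) (z N) = t * dist (z i) (z N) := by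
    intro i t ht
    have := hγ i t ht 0 (by simp)
    rw [hγ0, hγ1, sub_zero, abs_of_nonneg ht.1, dist_comm (z N)] at this
    exact this
  have key : ∀ i j, i < j → j < N →
      η * r ≤ dist (γ i (r / dist (z i) (z N))) (γ j (r / dist (z j) (z N))) := by
    intro i j hij hj
    have hi : i < N := by omega
    set ri := dist (z i) (z N) with hri
    set rj := dist (z j) (z N) with hrj
    have hri0 : 0 < ri := hrpos i hi
    have hrj0 : 0 < rj := hrpos j hj
    have hlt : rj < ri := hrlt i j hij hj
    have hc0 : 0 ≤ rj / ri := by positivity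
    have hc1 : rj / ri ≤ 1 := by rw [div_le_one hri0]; exact hlt.le
    have h1 := hB _ _ (aux_geod_restrict (hγ i) hc0 hc1) (hγ j)
      (by simp only [zero_mul, hγ0]) (r / rj) 1 (by positivity)
      (by rw [div_le_one hrj0]; exact hrle j hj) le_rfl
    simp only [one_mul, div_one, hγ1] at h1
    have e1 : r / rj * (rj / ri) = r / ri := by field_simp
    rw [e1, le_div_iff₀ (by positivity)] at h1
    -- lower bound on the distance at scale `rj`
    have h2 : η * rj ≤ dist (γ i (rj / ri)) (z j) := by
      have h3 := hcon i j hij hj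
      have h4 := hγ i (rj / ri) ⟨hc0, hc1⟩ 1 (by simp)
      rw [hγ1, hγ0, abs_sub_comm, abs_of_nonneg (by linarith), dist_comm (z N), ← hri] at h4
      have h5 : (1 - rj / ri) * ri = ri - rj := by field_simp
      rw [h5] at h4
      have h6 := dist_triangle_left (z i) (z j) (γ i (rj / ri))
      linarith
    refine le_trans ?_ h1
    calc η * r = η * rj * (r / rj) := by field_simp
      _ ≤ _ := by gcongr
  refine hM (z N) r hr0 (fun i => γ i (r / dist (z i) (z N))) (fun i => ?_) ?_
  · rw [hlen _ _ ⟨by positivity, by rw [div_le_one (hrpos i i.2)]; exact hrle i i.2⟩,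
      div_mul_cancel₀ _ (hrpos i i.2).ne']
  · intro i j hij
    rcases lt_or_gt_of_ne hij with h | h
    · exact key i j h j.2
    · rw [dist_comm]; exact key j i h i.2

theorem aux_lt_arccos {δ c : ℝ} (hδ0 : 0 < δ) (hδ : δ ≤ Real.pi) (hc : c < -Real.cos δ) :
    Real.pi - δ < Real.arccos c := by
  by_contra! h
  rcases le_or_gt c (-1) with h1 | h1
  · rw [Real.arccos_of_le_neg_one h1] at h
    linarith
  · have h2 := Real.cos_le_cos_of_nonneg_of_le_pi (Real.arccos_nonneg c) (by linarith) h
    rw [Real.cos_arccos h1.le (by linarith [Real.neg_one_le_cos δ]), Real.cos_pi_sub] at h2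
    linarith

theorem aux_arccos_lt {δ c : ℝ} (hδ0 : 0 < δ) (hc : Real.cos δ < c) :
    Real.arccos c < δ := by
  by_contra! h
  rcases le_or_gt 1 c with h1 | h1
  · rw [Real.arccos_of_one_le h1] at h
    linarith
  · have h2 := Real.cos_le_cos_of_nonneg_of_le_pi hδ0.le (Real.arccos_le_pi c) h
    rw [Real.cos_arccos (by linarith [Real.neg_one_le_cos δ]) h1.le] at h2
    linarith

theorem aux_arccos_half {δ c : ℝ} (hδ0 : 0 < δ) (hδ : δ < Real.pi / 2) (hc : |c| < Real.sin δ) :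
    |Real.arccos c - Real.pi / 2| < δ := by
  have hc' := abs_lt.1 hc
  have hcos : Real.cos (Real.pi / 2 + δ) = -Real.sin δ := by
    rw [add_comm, Real.cos_add_pi_div_two]
  have h1 : Real.arccos c < Real.pi / 2 + δ := aux_arccos_lt (by linarith) (by rw [hcos]; linarith)
  have h2 := aux_lt_arccos (δ := Real.pi / 2 + δ) (c := c) (by linarith) (by linarith)
    (by rw [hcos]; linarith)
  rw [abs_lt]
  constructor <;> linarith

/-- Almost horizontal and short implies almost orthogonal. -/
theorem aux_orth {X : Type*} [MetricSpace X] {δ : ℝ} (hδ0 : 0 < δ) (hδ : δ < Real.pi / 2)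
    (a y w : X) (hyw : y ≠ w) (hay : 0 < dist y a)
    (h : |dist a y - dist a w| < Real.sin δ / 3 * dist y w)
    (hs : dist y w < Real.sin δ / 3 * dist y a) :
    |compAngle a y w - Real.pi / 2| < δ := by
  refine aux_arccos_half hδ0 hδ ?_
  have hs0 : 0 < Real.sin δ := Real.sin_pos_of_pos_of_lt_pi hδ0 (by linarith)
  have hs1 : Real.sin δ ≤ 1 := Real.sin_le_one δ
  set ε := Real.sin δ / 3 with hε
  have hA : 0 < dist y w := dist_pos.2 hyw
  rw [dist_comm a y] at h
  set A := dist y w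
  set P := dist y a
  set Q := dist a w
  have hQ : 0 ≤ Q := dist_nonneg
  rw [abs_lt] at h
  have h3 : Real.sin δ = 3 * ε := by rw [hε]; ring
  have hε0 : 0 < ε := by positivity
  have hε1 : ε ≤ 1 := by linarith
  rw [h3, abs_div, abs_of_pos (show 0 < 2 * P * A by positivity), div_lt_iff₀ (by positivity), abs_lt]
  have hAP : A ≤ P := by nlinarith
  have hPQ : P + Q ≤ 3 * P := by nlinarith
  have e : P ^ 2 + A ^ 2 - Q ^ 2 = (P - Q) * (P + Q) + A ^ 2 := by ring
  have hA2 : A ^ 2 < ε * P * A := by nlinarith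
  have hA2' : 0 < A ^ 2 := by positivity
  have hpos : 0 < ε * A * P := by positivity
  have hb1 : (P - Q) * (P + Q) ≤ ε * A * (3 * P) := by
    calc (P - Q) * (P + Q) ≤ ε * A * (P + Q) := by
          apply mul_le_mul_of_nonneg_right h.2.le; positivity
      _ ≤ _ := by gcongr
  have hb2 : -(ε * A * (3 * P)) ≤ (P - Q) * (P + Q) := by
    have : (Q - P) * (P + Q) ≤ ε * A * (P + Q) := by
      apply mul_le_mul_of_nonneg_right (by linarith); positivity
    have h5 : ε * A * (P + Q) ≤ ε * A * (3 * P) := by gcongr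
    nlinarith
  rw [e]
  constructor <;> nlinarith

/-- Small excess implies comparison angle near `π`. -/
theorem aux_flat {X : Type*} [MetricSpace X] {δ : ℝ} (hδ0 : 0 < δ) (hδ : δ < Real.pi / 2)
    (a y b : X) (hy : y ≠ b) (hab : dist y b ≤ dist y a)
    (h : dist a y + dist y b - (1 - Real.cos δ) / 4 * dist y b ≤ dist a b) :
    Real.pi - δ < compAngle a y b := by
  refine aux_lt_arccos hδ0 (by linarith [Real.pi_pos]) ?_
  have hB : 0 < dist y b := dist_pos.2 hy
  have hcos : Real.cos δ < 1 := by
    rw [← Real.cos_zero]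
    exact Real.cos_lt_cos_of_nonneg_of_le_pi le_rfl (by linarith [Real.pi_pos]) hδ0
  have hcos0 := Real.neg_one_le_cos δ
  rw [dist_comm a y] at h
  set A := dist y a
  set B := dist y b
  set Q := dist a b
  have hA : 0 < A := by linarith
  rw [div_lt_iff₀ (by positivity)]
  set κ := 1 - Real.cos δ with hκ
  have hc : Real.cos δ = 1 - κ := by rw [hκ]; ring
  have hκ0 : 0 < κ := by linarith
  have hκ2 : κ ≤ 2 := by linarith
  rw [hc]
  have h0 : 0 ≤ A + B - κ / 4 * B := by nlinarith
  have h1 : (A + B - κ / 4 * B) ^ 2 ≤ Q ^ 2 := pow_le_pow_left₀ h0 h 2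
  have h2 : κ * B * B ≤ κ * A * B := by gcongr
  have h3 : 0 < κ * A * B := by positivity
  have h4 : 0 < κ * B * B := by positivity
  nlinarith [sq_nonneg (κ / 4 * B)]

theorem aux_continuousAt_compAngle {X : Type*} [MetricSpace X] (p q x : X) (hp : p ≠ x)
    (hq : q ≠ x) : ContinuousAt (fun y => compAngle p y q) x := by
  have h1 : 0 < dist x p := dist_pos.2 (Ne.symm hp)
  have h2 : 0 < dist x q := dist_pos.2 (Ne.symm hq)
  unfold compAngle
  refine Real.continuous_arccos.continuousAt.comp (ContinuousAt.div ?_ ?_ (by positivity))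
  · fun_prop
  · fun_prop

theorem aux_continuousAt_arccos {X : Type*} [MetricSpace X] (c : ℝ) (p q x : X) (hp : p ≠ x) :
    ContinuousAt (fun y => Real.arccos (1 - c * dist q y / (2 * dist p y))) x := by
  have h1 : 0 < dist p x := dist_pos.2 hp
  refine Real.continuous_arccos.continuousAt.comp
    (continuousAt_const.sub (ContinuousAt.div ?_ ?_ (by positivity)))
  · fun_prop
  · fun_prop

theorem aux_strainer_open {X : Type*} [MetricSpace X] (S C D δ : ℝ) {k : ℕ} (p q : Fin k → X)
    (x : X) (h : IsStrainer S C D δ x p q) : ∀ᶠ y in 𝓝 x, IsStrainer S C D δ y p q := by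
  obtain ⟨h1, h2, h3⟩ := h
  refine Filter.Eventually.and ?_ (Filter.Eventually.and ?_ ?_)
  · refine Filter.eventually_all.2 fun j => ?_
    obtain ⟨a, b, c, d⟩ := h1 j
    refine Filter.Eventually.and ?_ (Filter.Eventually.and ?_ (Filter.Eventually.and ?_ ?_))
    · filter_upwards [isOpen_ne.mem_nhds (Ne.symm a)] with w hw using Ne.symm hw
    · filter_upwards [isOpen_ne.mem_nhds (Ne.symm b)] with w hw using Ne.symm hw
    · exact (aux_continuousAt_compAngle _ _ _ a b).eventually (lt_mem_nhds c)
    · exact (aux_continuousAt_arccos _ _ _ _ a).eventually (gt_mem_nhds d)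
  · refine Filter.eventually_all.2 fun j => ?_
    by_cases hj : (j : ℕ) = 0
    · have hc : Continuous fun w => dist (p j) w := by fun_prop
      filter_upwards [(isOpen_lt hc continuous_const).mem_nhds (h2 j hj)] with w hw _ using hw
    · exact Filter.Eventually.of_forall fun w hw => absurd hw hj
  · refine Filter.eventually_all.2 fun i => Filter.eventually_all.2 fun j => ?_
    by_cases hij : i < j
    · obtain ⟨a, b, c⟩ := h3 i j hij
      have e1 := (aux_continuousAt_arccos (S + C) (p i) (p j) x (h1 i).1).eventually (gt_mem_nhds a)
      have e2 := (((aux_continuousAt_compAngle (p i) (p j) x (h1 i).1 (h1 j).1).sub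
        (continuousAt_const (y := Real.pi / 2))).abs).eventually (gt_mem_nhds b)
      have e3 := (((aux_continuousAt_compAngle (p i) (q j) x (h1 i).1 (h1 j).2.1).sub
        (continuousAt_const (y := Real.pi / 2))).abs).eventually (gt_mem_nhds c)
      filter_upwards [e1, e2, e3] with w a b c _ using ⟨a, b, c⟩
    · exact Filter.Eventually.of_forall fun w hw => absurd hw hij

theorem aux_extend {X : Type*} [MetricSpace X] (S C D δ : ℝ) {k : ℕ} (p q : Fin k → X)
    (x p' q' : X) (h : IsStrainer S C D δ x p q) (h1 : IsOneStrainer S δ x p' q')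
    (h0 : dist p' x < D)
    (h2 : ∀ i, Real.arccos (1 - (S + C) * dist p' x / (2 * dist (p i) x)) < δ ∧
      |compAngle (p i) x p' - Real.pi / 2| < δ ∧ |compAngle (p i) x q' - Real.pi / 2| < δ) :
    x ∈ strainedPoints X S C D δ (k + 1) := by
  refine ⟨Fin.snoc (α := fun _ => X) p p', Fin.snoc (α := fun _ => X) q q', ?_, ?_, ?_⟩
  · intro j
    induction j using Fin.lastCases with
    | last => simpa using h1
    | cast j => simpa using h.1 j
  · intro j
    induction j using Fin.lastCases with
    | last => intro _; simpa using h0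
    | cast j => intro hj; simpa using h.2.1 j (by simpa using hj)
  · intro i j
    induction j using Fin.lastCases with
    | last =>
      induction i using Fin.lastCases with
      | last => intro hh; exact absurd hh (lt_irrefl _)
      | cast i => intro _; simpa using h2 i
    | cast j =>
      induction i using Fin.lastCases with
      | last => intro hh; exact absurd (hh.trans (Fin.castSucc_lt_last j)) (lt_irrefl _)
      | cast i => intro hh; simpa using h.2.2 i j (by simpa using hh)

theorem aux_strained_anti {X : Type*} [MetricSpace X] (S C D δ : ℝ) :
    Antitone (strainedPoints X S C D δ) := by
  refine antitone_nat_of_succ_le fun k x hx => ?_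
  obtain ⟨p, q, h1, h2, h3⟩ := hx
  refine ⟨fun i => p i.castSucc, fun i => q i.castSucc, fun j => h1 _, fun j hj => h2 _ (by simpa using hj),
    fun i j hij => h3 _ _ (by simpa using hij)⟩

theorem aux_main {X : Type*} [MetricSpace X] [SecondCountableTopology X] (S C D δ : ℝ)
    (hS : 1 ≤ S) (hC : 0 ≤ C) (hD : 0 < D) (hδ0 : 0 < δ) (hδ : δ < Real.pi / 2)
    (hG : IsGeodesicSpace X) (hB : BusemannConcave X)
    (hP : ∀ η : ℝ, 0 < η → ∃ M : ℕ, ∀ (o : X) (r : ℝ), 0 < r → ∀ w : Fin M → X,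
      (∀ i, dist (w i) o ≤ r) → ¬ (∀ i j, i ≠ j → η * r ≤ dist (w i) (w j))) (k : ℕ) :
    dimH (strainedPoints X S C D δ k \ strainedPoints X S C D δ (k + 1)) ≤ k := by
  by_contra! hlt
  obtain ⟨x, hx, hx'⟩ := exists_mem_nhdsWithin_lt_dimH_of_lt_dimH hlt
  obtain ⟨⟨p, q, hpq⟩, -⟩ := hx
  have hs0 : 0 < Real.sin δ := Real.sin_pos_of_pos_of_lt_pi hδ0 (by linarith)
  have hcos : Real.cos δ < 1 := by
    rw [← Real.cos_zero]
    exact Real.cos_lt_cos_of_nonneg_of_le_pi le_rfl (by linarith [Real.pi_pos]) hδ0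
  have hκ0 : 0 < 1 - Real.cos δ := by linarith
  -- choice of the radius
  have hρ : ∀ᶠ ρ in 𝓝[>] (0 : ℝ), 0 < ρ ∧ ρ < D ∧ ∀ a,
      ρ < Real.sin δ / 3 * (dist (p a) x - ρ) ∧
      (S + C) * ρ < (1 - Real.cos δ) * (dist (p a) x - ρ) := by
    refine Filter.Eventually.and self_mem_nhdsWithin (Filter.Eventually.and ?_
      (Filter.eventually_all.2 fun a => ?_))
    · exact nhdsWithin_le_nhds (gt_mem_nhds hD)
    · have hd : 0 < dist (p a) x := dist_pos.2 (hpq.1 a).1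
      have c1 : Continuous fun ρ : ℝ => Real.sin δ / 3 * (dist (p a) x - ρ) := by fun_prop
      have c2 : Continuous fun ρ : ℝ => (S + C) * ρ := by fun_prop
      have c3 : Continuous fun ρ : ℝ => (1 - Real.cos δ) * (dist (p a) x - ρ) := by fun_prop
      refine nhdsWithin_le_nhds (Filter.Eventually.and ?_ ?_)
      · refine (isOpen_lt continuous_id c1).mem_nhds ?_
        simp only [Set.mem_setOf_eq, id, sub_zero]; positivity
      · refine (isOpen_lt c2 c3).mem_nhds ?_
        simp only [Set.mem_setOf_eq, mul_zero, sub_zero]; positivity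
  obtain ⟨ρ, hρ0, hρD, hρa⟩ := hρ.exists
  set E := strainedPoints X S C D δ k \ strainedPoints X S C D δ (k + 1) with hE
  have hE' := hx' (E ∩ ({y | IsStrainer S C D δ y p q} ∩ Metric.ball x (ρ / 2)))
    (inter_mem self_mem_nhdsWithin (mem_nhdsWithin_of_mem_nhds (inter_mem
      (aux_strainer_open S C D δ p q x hpq) (Metric.ball_mem_nhds x (by positivity)))))
  obtain ⟨M, hM⟩ := hP ((1 - Real.cos δ) / 4) (by positivity)
  have hM0 : 0 < M := by
    rcases Nat.eq_zero_or_pos M with h | h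
    · subst h
      exact absurd (fun i => Fin.elim0 i) (hM x 1 one_pos Fin.elim0 (fun i => Fin.elim0 i))
    · exact h
  have hlam : 0 < min (1 / 2) ((1 - Real.cos δ) / S) := by
    apply lt_min <;> positivity
  obtain ⟨z, hz1, hz2, hz3⟩ := aux_sequence p (Real.sin δ / 3) _ (by positivity) hlam M _ hE'
  obtain ⟨i, j, hij, hj, hflat⟩ := aux_straight hG hB ((1 - Real.cos δ) / 4) M hM0 hM z
    (fun i j h1 h2 => (hz2 i j h1 h2).1) (fun i j l h1 h2 h3 => (hz3 i j l h1 h2 h3).trans_le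
      (mul_le_mul_of_nonneg_right (min_le_left _ _) dist_nonneg))
  obtain ⟨hzi, -, hbi⟩ := hz1 i (by omega)
  obtain ⟨hzj, hstr, hbj⟩ := hz1 j (by omega)
  obtain ⟨hzN, -, hbN⟩ := hz1 M le_rfl
  rw [Metric.mem_ball] at hbi hbj hbN
  obtain ⟨hneij, hHij⟩ := hz2 i j hij hj.le
  obtain ⟨hnejN, hHjN⟩ := hz2 j M hj le_rfl
  have h3 := hz3 i j M hij hj le_rfl
  have hdij : 0 < dist (z i) (z j) := dist_pos.2 hneij
  have h3a : dist (z j) (z M) ≤ dist (z j) (z i) := by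
    rw [dist_comm (z j) (z i)]
    have := mul_le_mul_of_nonneg_right (min_le_left (1 / 2) ((1 - Real.cos δ) / S))
      (dist_nonneg (x := z i) (y := z j))
    linarith
  have h3b : S * dist (z j) (z M) < (1 - Real.cos δ) * dist (z i) (z j) := by
    have := mul_le_mul_of_nonneg_right (min_le_right (1 / 2) ((1 - Real.cos δ) / S))
      (dist_nonneg (x := z i) (y := z j))
    have h4 := h3.trans_le this
    rw [div_mul_eq_mul_div, lt_div_iff₀ (by linarith)] at h4
    linarith
  have hdρ1 : dist (z j) (z i) < ρ := by
    have := dist_triangle_right (z j) (z i) x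
    linarith
  have hdρ2 : dist (z j) (z M) < ρ := by
    have := dist_triangle_right (z j) (z M) x
    linarith
  refine hzj.2 (aux_extend S C D δ p q (z j) (z i) (z M) hstr ⟨hneij, Ne.symm hnejN, ?_, ?_⟩ ?_ ?_)
  · exact aux_flat hδ0 hδ (z i) (z j) (z M) hnejN h3a hflat
  · refine aux_arccos_lt hδ0 ?_
    rw [dist_comm (z M)]
    have : S * dist (z j) (z M) / (2 * dist (z i) (z j)) < 1 - Real.cos δ := by
      rw [div_lt_iff₀ (by positivity)]
      nlinarith [mul_pos hκ0 hdij]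
    linarith
  · rw [dist_comm]; linarith
  · intro a
    obtain ⟨ha1, ha2⟩ := hρa a
    have hP' : dist (p a) x - ρ < dist (p a) (z j) := by
      have := dist_triangle (p a) (z j) x
      linarith
    have hPpos : 0 < dist (p a) (z j) := by
      have : 0 < dist (p a) x - ρ := by
        by_contra! hh
        nlinarith
      linarith
    have hρs : ρ < Real.sin δ / 3 * dist (z j) (p a) := by
      rw [dist_comm (z j)]
      refine ha1.trans ?_
      gcongr
    refine ⟨aux_arccos_lt hδ0 ?_, ?_, ?_⟩
    · have : (S + C) * dist (z i) (z j) / (2 * dist (p a) (z j)) < 1 - Real.cos δ := by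
        rw [div_lt_iff₀ (by positivity)]
        have e1 : (S + C) * dist (z i) (z j) ≤ (S + C) * ρ := by
          rw [dist_comm (z i)]
          gcongr
        have e2 : (1 - Real.cos δ) * (dist (p a) x - ρ) < (1 - Real.cos δ) * dist (p a) (z j) := by
          gcongr
        nlinarith [mul_pos hκ0 hPpos]
      linarith
    · refine aux_orth hδ0 hδ (p a) (z j) (z i) (Ne.symm hneij) (by rwa [dist_comm]) ?_ (by linarith)
      rw [abs_sub_comm, dist_comm (z j)]
      exact hHij a
    · exact aux_orth hδ0 hδ (p a) (z j) (z M) hnejN (by rwa [dist_comm]) (hHjN a) (by linarith)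

/-- stratification of `X` by the sets of strained points, for `S`
sufficiently close to `1`. -/
theorem stmt_5 (n : ℕ) (δ : ℝ) (hδ0 : 0 < δ) (hδ : δ < strainerDelta (n + 1)) :
    ∃ S₁ : ℝ, 1 < S₁ ∧
      ∀ (X : Type) [MetricSpace X] [CompleteSpace X],
        ∀ S C D : ℝ, 1 ≤ S → S ≤ S₁ → 0 ≤ C → 0 < D →
          IsGeodesicSpace X → SConcave X S → LocSemiConvex X C D →
          BusemannConcave X → dimH (Set.univ : Set X) = n →
          ∀ Xs : ℕ → Set X,
            (∀ k, k ≤ n →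
              Xs k = if k = n then strainedPoints X S C D δ n
                else strainedPoints X S C D δ k \ strainedPoints X S C D δ (k + 1)) →
            (∀ i j, i ≤ n → j ≤ n → i ≠ j → Disjoint (Xs i) (Xs j)) ∧
            (⋃ k ∈ Set.Iic n, Xs k) = Set.univ ∧
            ∀ k, k ≤ n → dimH (Xs k) ≤ (k : ENNReal) := by
  refine ⟨2, by norm_num, ?_⟩
  intro X _ _ S C D hS _ hC hD hG _ _ hB hdim Xs hXs
  have hδπ : δ < Real.pi / 2 := by
    have h1 : strainerDelta (n + 1) ≤ 1 := by
      unfold strainerDelta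
      refine inv_le_one_of_one_le₀ ?_
      have h2 : (1 : ℝ) ≤ 2 ^ (2 * (n + 1) + 1) := one_le_pow₀ (by norm_num)
      have h3 : (1 : ℝ) ≤ ((n + 1 : ℕ) : ℝ) := by push_cast; linarith [Nat.cast_nonneg (α := ℝ) n]
      nlinarith
    linarith [Real.pi_gt_three]
  have hP := aux_packing hG hB n hdim
  have := aux_secondCountable hP
  have hanti := aux_strained_anti (X := X) S C D δ
  have hsub : ∀ k ≤ n, Xs k ⊆ strainedPoints X S C D δ k := by
    intro k hk
    rw [hXs k hk]
    split_ifs with h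
    · rw [h]
    · exact Set.diff_subset
  have hdisj : ∀ i j, i < j → j ≤ n → Disjoint (Xs i) (Xs j) := by
    intro i j hij hj
    rw [hXs i (by omega), if_neg (by omega)]
    refine Set.disjoint_left.2 fun x hx hx2 => hx.2 ?_
    exact hanti (show i + 1 ≤ j by omega) (hsub j hj hx2)
  refine ⟨?_, ?_, ?_⟩
  · intro i j hi hj hij
    rcases lt_or_gt_of_ne hij with h | h
    · exact hdisj i j h hj
    · exact (hdisj j i h hi).symm
  · refine Set.eq_univ_of_forall fun x => ?_
    classical
    have h0 : x ∈ strainedPoints X S C D δ 0 :=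
      ⟨Fin.elim0, Fin.elim0, fun j => Fin.elim0 j, fun j => Fin.elim0 j, fun j => Fin.elim0 j⟩
    set m := Nat.findGreatest (fun k => x ∈ strainedPoints X S C D δ k) n with hm
    have hmn : m ≤ n := Nat.findGreatest_le n
    have hmx : x ∈ strainedPoints X S C D δ m :=
      Nat.findGreatest_spec (P := fun k => x ∈ strainedPoints X S C D δ k) (Nat.zero_le n) h0
    simp only [Set.mem_iUnion]
    refine ⟨m, hmn, ?_⟩
    rw [hXs m hmn]
    split_ifs with h
    · rw [← h]; exact hmx
    · refine ⟨hmx, ?_⟩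
      exact Nat.findGreatest_is_greatest (P := fun k => x ∈ strainedPoints X S C D δ k)
        (Nat.lt_succ_self _) (by omega)
  · intro k hk
    by_cases h : k = n
    · rw [h, ← hdim]
      exact dimH_mono (Set.subset_univ _)
    · rw [hXs k hk, if_neg h]
      exact aux_main S C D δ hS hC hD hδ0 hδπ hG hB hP k
end
end

section
/- Let X be an S-concave (S ≥ 1), (C,D)-locally semi-convex, Busemann concave complete geodesic space, let x ∈ X and m ∈ ℕ with m ≥ 1. Suppose that for every δ ∈ (0, δ_m) every open neighborhood of x contains an (m,δ)-strained point, while there exist δ' ∈ (0, δ_{m+1}) and an open neighborhood of x containing no (m+1,δ')-strained point (where δ_k := k⁻¹·2^{−2k−1}). Then every open neighborhood U of x has Hausdorff dimension equal to m. -/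
open Set Metric MeasureTheory Filter Topology

noncomputable section

variable {X : Type*} [MetricSpace X]

/-! ### Elementary facts on `arccos` -/

lemma aux_cos_ge {δ : ℝ} (h0 : 0 < δ) (h1 : δ < 1) : 1 - δ ≤ Real.cos δ := by
  have := Real.one_sub_sq_div_two_le_cos (x := δ)
  nlinarith

lemma aux_arccos_pi {δ z : ℝ} (h0 : 0 < δ) (h1 : δ < 1)
    (h : Real.pi - δ < Real.arccos z) : z < -(1 - δ) := by
  by_contra hz
  push Not at hz
  have h2 := aux_cos_ge h0 h1
  have h3 : Real.arccos z ≤ Real.arccos (-Real.cos δ) :=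
    Real.antitone_arccos (by linarith)
  rw [Real.arccos_neg, Real.arccos_cos h0.le (by linarith [Real.pi_gt_three])] at h3
  linarith

lemma aux_arccos_lt_s8 {δ z : ℝ} (h0 : 0 < δ) (h1 : δ < 1)
    (h : Real.arccos z < δ) : 1 - δ < z := by
  by_contra hz
  push Not at hz
  have h2 := aux_cos_ge h0 h1
  have h3 : Real.arccos (Real.cos δ) ≤ Real.arccos z :=
    Real.antitone_arccos (by linarith)
  rw [Real.arccos_cos h0.le (by linarith [Real.pi_gt_three])] at h3
  linarith

lemma aux_arccos_half_s8 {δ z : ℝ} (h0 : 0 < δ) (h1 : δ < 1)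
    (h : |Real.arccos z - Real.pi / 2| < δ) : |z| ≤ δ := by
  rw [abs_lt] at h
  have hs : Real.sin δ ≤ δ := Real.sin_le h0.le
  have hp := Real.pi_gt_three
  rw [abs_le]
  constructor
  · by_contra hz
    push Not at hz
    have h3 : Real.arccos (Real.cos (Real.pi / 2 + δ)) ≤ Real.arccos z := by
      apply Real.antitone_arccos
      rw [add_comm, Real.cos_add_pi_div_two]; linarith
    rw [Real.arccos_cos (by linarith) (by linarith)] at h3
    linarith
  · by_contra hz
    push Not at hz
    have h3 : Real.arccos z ≤ Real.arccos (Real.cos (Real.pi / 2 - δ)) := by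
      apply Real.antitone_arccos
      rw [Real.cos_pi_div_two_sub]; linarith
    rw [Real.arccos_cos (by linarith) (by linarith)] at h3
    linarith

lemma aux_small_half {δ : ℝ} (h0 : 0 < δ) :
    ∃ η > 0, ∀ z : ℝ, |z| < η → |Real.arccos z - Real.pi / 2| < δ := by
  obtain ⟨η, hη, h⟩ := Metric.continuous_iff.1 Real.continuous_arccos 0 δ h0
  refine ⟨η, hη, fun z hz => ?_⟩
  have := h z (by simpa [Real.dist_eq] using hz)
  simpa [Real.dist_eq] using this

lemma aux_small_zero {δ : ℝ} (h0 : 0 < δ) :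
    ∃ η > 0, ∀ z : ℝ, |z| < η → Real.arccos (1 - z) < δ := by
  obtain ⟨η, hη, h⟩ := Metric.continuous_iff.1 Real.continuous_arccos 1 δ h0
  refine ⟨η, hη, fun z hz => ?_⟩
  have := h (1 - z) (by simpa [Real.dist_eq] using hz)
  rw [Real.dist_eq, Real.arccos_one, sub_zero] at this
  exact lt_of_abs_lt this

lemma aux_sq {a b : ℝ} (h : a ^ 2 ≤ b ^ 2) (hb : 0 ≤ b) : a ≤ b :=
  (le_abs_self a).trans (abs_le_of_sq_le_sq h hb)

/-! ### Ekeland-type argument -/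

lemma aux_ekeland {X : Type*} [MetricSpace X] [CompleteSpace X] (A : Set X) (hA : IsClosed A)
    (Ψ : X → ℝ) (hΨ : Continuous Ψ) (c : ℝ) (hc : 0 < c) (y : X) (hy : y ∈ A)
    (hpos : ∀ u ∈ A, 0 ≤ Ψ u)
    (hstep : ∀ u ∈ A, 0 < Ψ u → c * dist y u ≤ Ψ y →
      ∃ u' ∈ A, u' ≠ u ∧ Ψ u' + c * dist u u' ≤ Ψ u) :
    ∃ u ∈ A, Ψ u = 0 ∧ c * dist y u ≤ Ψ y := by
  classical
  let T : X → Set X := fun u => {u' | u' ∈ A ∧ Ψ u' + c * dist u u' ≤ Ψ u}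
  have hself : ∀ u ∈ A, u ∈ T u := fun u hu => ⟨hu, by simp⟩
  have htrans : ∀ u v w, v ∈ T u → w ∈ T v → w ∈ T u := by
    rintro u v w ⟨-, h1⟩ ⟨hw, h2⟩
    refine ⟨hw, ?_⟩
    have := mul_le_mul_of_nonneg_left (dist_triangle u v w) hc.le
    linarith
  have hclosed : ∀ u, IsClosed (T u) := fun u =>
    hA.inter (isClosed_le (f := fun u' => Ψ u' + c * dist u u') (g := fun _ => Ψ u)
      (by fun_prop) continuous_const)
  have hbdd : ∀ u, BddBelow (Ψ '' T u) := fun u =>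
    ⟨0, by rintro _ ⟨v, hv, rfl⟩; exact hpos v hv.1⟩
  have hnext : ∀ (n : ℕ) (u : A), ∃ v : A, (v : X) ∈ T u ∧
      ∀ w ∈ T u, Ψ v ≤ Ψ w + (1/2 : ℝ) ^ n := by
    intro n u
    have hne : (Ψ '' T u).Nonempty := ⟨_, u, hself u u.2, rfl⟩
    obtain ⟨_, ⟨v, hv, rfl⟩, hlt⟩ := exists_lt_of_csInf_lt hne
      (show sInf (Ψ '' T u) < sInf (Ψ '' T u) + (1/2 : ℝ) ^ n by
        have : (0:ℝ) < (1/2 : ℝ) ^ n := by positivity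
        linarith)
    refine ⟨⟨v, hv.1⟩, hv, fun w hw => ?_⟩
    have := csInf_le (hbdd u) ⟨w, hw, rfl⟩
    show Ψ v ≤ _
    linarith
  choose nx hnx1 hnx2 using hnext
  let s : ℕ → A := fun n => Nat.rec (motive := fun _ => A) ⟨y, hy⟩ (fun n u => nx n u) n
  have hs1 : ∀ n : ℕ, (s (n+1)).1 ∈ T (s n).1 := fun n => hnx1 n (s n)
  have hs2 : ∀ n : ℕ, ∀ w ∈ T (s n).1, Ψ (s (n+1)) ≤ Ψ w + (1/2 : ℝ) ^ n := fun n => hnx2 n (s n)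
  have hmem : ∀ n k : ℕ, (s (n + k)).1 ∈ T (s n).1 := by
    intro n k
    induction k with
    | zero => exact hself _ (s n).2
    | succ k ih => exact htrans _ _ _ ih (hs1 (n + k))
  have hcau : CauchySeq (fun n => ((s n : A) : X)) := by
    rw [Metric.cauchySeq_iff']
    intro ε hε
    obtain ⟨N, hN⟩ := exists_pow_lt_of_lt_one (mul_pos hc hε) (by norm_num : (1/2 : ℝ) < 1)
    refine ⟨N + 1, fun n hn => ?_⟩
    obtain ⟨k, rfl⟩ := Nat.exists_eq_add_of_le hn
    have h1 := hmem (N + 1) k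
    have h2 := hs2 N _ (htrans _ _ _ (hs1 N) h1)
    have h3 := h1.2
    rw [dist_comm]
    by_contra hcon
    push Not at hcon
    have := mul_le_mul_of_nonneg_left hcon hc.le
    linarith
  obtain ⟨u, hu⟩ := cauchySeq_tendsto_of_complete hcau
  have huT : ∀ n : ℕ, u ∈ T (s n).1 := by
    intro n
    refine (hclosed (s n)).mem_of_tendsto hu ?_
    filter_upwards [eventually_ge_atTop n] with k hk
    obtain ⟨j, rfl⟩ := Nat.exists_eq_add_of_le hk
    exact hmem n j
  have huA : u ∈ A := (huT 0).1
  have hyu : Ψ u + c * dist y u ≤ Ψ y := (huT 0).2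
  have hyu' : c * dist y u ≤ Ψ y := by linarith [hpos u huA]
  refine ⟨u, huA, ?_, hyu'⟩
  by_contra hne
  obtain ⟨u', hu', hneq, hle⟩ := hstep u huA (lt_of_le_of_ne (hpos u huA) (Ne.symm hne)) hyu'
  have hd : 0 < c * dist u u' := mul_pos hc (dist_pos.2 hneq.symm)
  obtain ⟨N, hN⟩ := exists_pow_lt_of_lt_one hd (by norm_num : (1/2 : ℝ) < 1)
  have h1 := hs2 N u' (htrans _ _ _ (huT N) ⟨hu', hle⟩)
  have h2 := (huT (N + 1)).2
  have h3 : 0 ≤ c * dist ((s (N+1) : A) : X) u := by positivity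
  linarith

/-! ### Transfer of dimension by Busemann concavity -/

lemma aux_transfer {X : Type*} [MetricSpace X] (hgeo : IsGeodesicSpace X)
    (hbus : BusemannConcave X) (y z : X) (r R : ℝ) (hr : 0 < r) :
    dimH (ball z R) ≤ dimH (ball y r) := by
  choose γ hγ hγ0 hγ1 using hgeo y
  obtain ⟨t, ht0, ht1, ht⟩ : ∃ t : ℝ, 0 < t ∧ t ≤ 1 ∧ t * (|R| + dist y z + 1) ≤ r := by
    have hp : 0 < |R| + dist y z + 1 := by positivity
    refine ⟨min 1 (r / (|R| + dist y z + 1)), by positivity, min_le_left _ _, ?_⟩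
    calc _ ≤ (r / (|R| + dist y z + 1)) * (|R| + dist y z + 1) := by
          gcongr; exact min_le_right _ _
      _ = r := by field_simp
  have hanti : AntilipschitzWith (Real.toNNReal t⁻¹) (fun w => γ w t) := by
    refine AntilipschitzWith.of_le_mul_dist fun w w' => ?_
    have := hbus (γ w) (γ w') (hγ w) (hγ w') (by rw [hγ0, hγ0]) t 1 ht0 ht1 le_rfl
    rw [hγ1, hγ1, div_one] at this
    rw [Real.coe_toNNReal _ (by positivity)]
    rw [div_eq_inv_mul] at this
    exact this
  refine (hanti.le_dimH_image (ball z R)).trans (dimH_mono ?_)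
  rintro _ ⟨w, hw, rfl⟩
  have h1 := hγ w t ⟨ht0.le, ht1⟩ 0 ⟨le_rfl, zero_le_one⟩
  rw [hγ0, hγ1, sub_zero, abs_of_pos ht0] at h1
  rw [mem_ball] at hw ⊢
  rw [h1]
  have h2 := dist_triangle y z w
  rw [dist_comm z w] at h2
  have h3 := le_abs_self R
  refine lt_of_lt_of_le ?_ ht
  gcongr
  linarith

/-! ### Openness of the strainer condition -/

lemma aux_compAngle_cont {p q y : X} (hp : p ≠ y) (hq : q ≠ y) :
    ContinuousAt (fun u => compAngle p u q) y := by
  unfold compAngle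
  refine Real.continuous_arccos.continuousAt.comp ?_
  have h1 : dist y p ≠ 0 := dist_ne_zero.2 hp.symm
  have h2 : dist y q ≠ 0 := dist_ne_zero.2 hq.symm
  refine ContinuousAt.div (by fun_prop) (by fun_prop) (by positivity)

lemma aux_arccos_cont {a : ℝ} {p q y : X} (hp : p ≠ y) :
    ContinuousAt (fun u => Real.arccos (1 - a * dist q u / (2 * dist p u))) y := by
  refine Real.continuous_arccos.continuousAt.comp ?_
  have h1 : dist p y ≠ 0 := dist_ne_zero.2 hp
  refine continuousAt_const.sub (ContinuousAt.div (by fun_prop) (by fun_prop) (by positivity))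

lemma aux_open {S C D δ : ℝ} {y : X} {k : ℕ} {p q : Fin k → X}
    (h : IsStrainer S C D δ y p q) : ∀ᶠ u in 𝓝 y, IsStrainer S C D δ u p q := by
  obtain ⟨h1, h2, h3⟩ := h
  refine Filter.Eventually.and ?_ (Filter.Eventually.and ?_ ?_)
  · refine eventually_all.2 fun j => ?_
    obtain ⟨a, b, c, d⟩ := h1 j
    filter_upwards [isOpen_ne.mem_nhds a.symm, isOpen_ne.mem_nhds b.symm,
      (aux_compAngle_cont a b).eventually (lt_mem_nhds c),
      (aux_arccos_cont a).eventually (gt_mem_nhds d)] with u x1 x2 x3 x4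
    exact ⟨Ne.symm x1, Ne.symm x2, x3, x4⟩
  · refine eventually_all.2 fun j => ?_
    by_cases hj : (j : ℕ) = 0
    · have : ContinuousAt (fun u => dist (p j) u) y := by fun_prop
      filter_upwards [this.eventually (gt_mem_nhds (h2 j hj))] with u hu _ using hu
    · exact Filter.Eventually.of_forall fun u hu => absurd hu hj
  · refine eventually_all.2 fun i => eventually_all.2 fun j => ?_
    by_cases hij : i < j
    · obtain ⟨a, b, c⟩ := h3 i j hij
      have e1 : ContinuousAt (fun u => |compAngle (p i) u (p j) - Real.pi / 2|) y :=
        ((aux_compAngle_cont (h1 i).1 (h1 j).1).sub continuousAt_const).abs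
      have e2 : ContinuousAt (fun u => |compAngle (p i) u (q j) - Real.pi / 2|) y :=
        ((aux_compAngle_cont (h1 i).1 (h1 j).2.1).sub continuousAt_const).abs
      filter_upwards [(aux_arccos_cont (h1 i).1).eventually (gt_mem_nhds a),
        e1.eventually (gt_mem_nhds b), e2.eventually (gt_mem_nhds c)] with u x1 x2 x3 _
      exact ⟨x1, x2, x3⟩
    · exact Filter.Eventually.of_forall fun u hu => absurd hu hij

lemma aux_mono {S C D δ δ' : ℝ} {y : X} {k : ℕ} {p q : Fin k → X} (hδ : δ ≤ δ')
    (h : IsStrainer S C D δ y p q) : IsStrainer S C D δ' y p q := by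
  obtain ⟨h1, h2, h3⟩ := h
  refine ⟨fun j => ?_, h2, fun i j hij => ?_⟩
  · obtain ⟨a, b, c, d⟩ := h1 j
    exact ⟨a, b, by linarith, by linarith⟩
  · obtain ⟨a, b, c⟩ := h3 i j hij
    exact ⟨by linarith, by linarith, by linarith⟩

/-! ### Numerical consequences of the strainer conditions -/

lemma aux_one {S δ : ℝ} {u p q : X} (h0 : 0 < δ) (h1 : δ < 1) (h : IsOneStrainer S δ u p q) :
    0 < dist p u ∧ 0 < dist q u ∧
      dist p u ^ 2 + dist q u ^ 2 + 2 * dist p u * dist q u * (1 - δ) ≤ dist p q ^ 2 ∧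
      S * dist q u ≤ 2 * dist p u * δ := by
  obtain ⟨a, b, c, d⟩ := h
  have ha : 0 < dist p u := dist_pos.2 a
  have hb : 0 < dist q u := dist_pos.2 b
  have c' := aux_arccos_pi h0 h1 c
  have d' := aux_arccos_lt_s8 h0 h1 d
  rw [dist_comm u p, dist_comm u q, div_lt_iff₀ (by positivity)] at c'
  have d2 : S * dist q u / (2 * dist p u) < δ := by linarith
  rw [div_lt_iff₀ (by positivity)] at d2
  exact ⟨ha, hb, by nlinarith, by nlinarith⟩

lemma aux_ratio {a δ : ℝ} {u p q : X} (h0 : 0 < δ) (h1 : δ < 1) (hp : 0 < dist p u)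
    (h : Real.arccos (1 - a * dist q u / (2 * dist p u)) < δ) :
    a * dist q u ≤ 2 * dist p u * δ := by
  have d' := aux_arccos_lt_s8 h0 h1 h
  have d2 : a * dist q u / (2 * dist p u) < δ := by linarith
  rw [div_lt_iff₀ (by positivity)] at d2
  nlinarith

lemma aux_orth_s8 {δ : ℝ} {u p q : X} (h0 : 0 < δ) (h1 : δ < 1) (hp : 0 < dist p u)
    (hq : 0 < dist q u) (h : |compAngle p u q - Real.pi / 2| < δ) :
    |dist p u ^ 2 + dist q u ^ 2 - dist p q ^ 2| ≤ 2 * dist p u * dist q u * δ := by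
  have h2 := aux_arccos_half_s8 h0 h1 h
  rw [dist_comm u p, dist_comm u q, abs_div, div_le_iff₀ (by positivity),
    abs_of_pos (by positivity : 0 < 2 * dist p u * dist q u)] at h2
  linarith

/-- rate of increase of the distance to `p` in the direction of the opposite strainer. -/
lemma aux_toward_q {S δ : ℝ} {u p q : X} (hconc : SConcave X S)
    (h0 : 0 < δ) (h1 : δ < 1 / 4) (h : IsOneStrainer S δ u p q)
    {γ : ℝ → X} (hγ : IsConstSpeedGeodesic γ) (hγ0 : γ 0 = u) (hγ1 : γ 1 = q) {t : ℝ}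
    (ht0 : 0 ≤ t) (ht1 : t ≤ 1) (hs : t * dist q u ≤ 2 * dist p u * δ) (hS : 1 ≤ S) :
    dist p u + (1 - 3 * δ) * (t * dist q u) ≤ dist p (γ t) := by
  obtain ⟨ha, hb, hc, hd⟩ := aux_one h0 (by linarith) h
  have key := hconc p γ hγ t ⟨ht0, ht1⟩
  rw [hγ0, hγ1, dist_comm u q] at key
  set a := dist p u
  set l := dist q u
  refine aux_sq ?_ dist_nonneg
  have e1 : t * (a ^ 2 + l ^ 2 + 2 * a * l * (1 - δ)) ≤ t * dist p q ^ 2 := by gcongr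
  have e2 : (t * l) * (S * l) ≤ (t * l) * (2 * a * δ) := by gcongr
  have e3 : S * t * (1 - t) * l ^ 2 ≤ S * t * l ^ 2 := by
    have : 0 ≤ S * t * t * l ^ 2 := by positivity
    nlinarith
  have e4 : (t * l) * (t * l) ≤ (t * l) * (2 * a * δ) := by gcongr
  have e5 : (1 - 3 * δ) ^ 2 * ((t * l) * (t * l)) ≤ 1 * ((t * l) * (t * l)) := by
    gcongr
    nlinarith
  have e6 : 0 ≤ t * l ^ 2 := by positivity
  nlinarith

lemma aux_orth_lower {S δ : ℝ} {u p b : X} (hconc : SConcave X S) (h0 : 0 < δ)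
    (ho : |dist p u ^ 2 + dist b u ^ 2 - dist p b ^ 2| ≤ 2 * dist p u * dist b u * δ)
    (hr : S * dist b u ≤ 2 * dist p u * δ)
    {γ : ℝ → X} (hγ : IsConstSpeedGeodesic γ) (hγ0 : γ 0 = u) (hγ1 : γ 1 = b) {t : ℝ}
    (ht0 : 0 ≤ t) (ht1 : t ≤ 1) (hS : 1 ≤ S) :
    dist p u - 4 * δ * (t * dist b u) ≤ dist p (γ t) := by
  have key := hconc p γ hγ t ⟨ht0, ht1⟩
  rw [hγ0, hγ1, dist_comm u b] at key
  have ha : 0 ≤ dist p u := dist_nonneg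
  have hb : 0 ≤ dist b u := dist_nonneg
  set a := dist p u
  set l := dist b u
  rcases le_or_gt (a - 4 * δ * (t * l)) 0 with hneg | hpos
  · exact hneg.trans dist_nonneg
  refine aux_sq ?_ dist_nonneg
  have e1 : t * (a ^ 2 + l ^ 2 - dist p b ^ 2) ≤ t * (2 * a * l * δ) := by
    gcongr; exact (abs_le.1 ho).2
  have e2 : (t * l) * (S * l) ≤ (t * l) * (2 * a * δ) := by gcongr
  have e3 : S * t * (1 - t) * l ^ 2 ≤ S * t * l ^ 2 := by
    have : 0 ≤ S * t * t * l ^ 2 := by positivity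
    nlinarith
  have e4 : (4 * δ * (t * l)) * (4 * δ * (t * l)) ≤ (4 * δ * (t * l)) * a := by
    gcongr; linarith
  have e6 : 0 ≤ t * l ^ 2 := by positivity
  nlinarith

lemma aux_orth_upper {C D δ : ℝ} {u p b : X} (hsemi : LocSemiConvex X C D) (h0 : 0 < δ)
    (hC : 0 ≤ C)
    (ho : |dist p u ^ 2 + dist b u ^ 2 - dist p b ^ 2| ≤ 2 * dist p u * dist b u * δ)
    (hr : (1 + C) * dist b u ≤ 2 * dist p u * δ) (hD : dist p u + dist b u < D)
    {γ : ℝ → X} (hγ : IsConstSpeedGeodesic γ) (hγ0 : γ 0 = u) (hγ1 : γ 1 = b) {t : ℝ}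
    (ht0 : 0 ≤ t) (ht1 : t ≤ 1) :
    dist p (γ t) ≤ dist p u + 4 * δ * (t * dist b u) := by
  have key := hsemi p γ hγ (fun s hs => by
    have h1 := hγ 0 ⟨le_rfl, zero_le_one⟩ s hs
    rw [hγ0, hγ1, zero_sub, abs_neg, abs_of_nonneg hs.1, dist_comm u b] at h1
    have h2 := dist_triangle p u (γ s)
    have h3 : s * dist b u ≤ 1 * dist b u := by gcongr; exact hs.2
    linarith) t ⟨ht0, ht1⟩
  rw [hγ0, hγ1, dist_comm u b] at key
  have ha : 0 ≤ dist p u := dist_nonneg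
  have hb : 0 ≤ dist b u := dist_nonneg
  set a := dist p u
  set l := dist b u
  refine aux_sq ?_ (by positivity)
  have e1 : t * (-(2 * a * l * δ)) ≤ t * (a ^ 2 + l ^ 2 - dist p b ^ 2) := by
    gcongr; exact (abs_le.1 ho).1
  have e2 : (t * l) * ((1 + C) * l) ≤ (t * l) * (2 * a * δ) := by gcongr
  have e3 : C * t * (1 - t) * l ^ 2 ≤ C * t * l ^ 2 := by
    have : 0 ≤ C * t * t * l ^ 2 := by positivity
    nlinarith
  have e6 : 0 ≤ a * δ * (t * l) := by positivity
  have e7 : 0 ≤ (4 * δ * (t * l)) ^ 2 := by positivity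
  nlinarith

/-! ### Upper bound: the strainer map is locally bi-Lipschitz -/

set_option maxHeartbeats 1000000 in
lemma aux_B {S C D δ : ℝ} (hS : 1 ≤ S) (hC : 0 ≤ C) (hD : 0 < D) (hδ : 0 < δ)
    (hgeo : IsGeodesicSpace X) (hconc : SConcave X S) (hsemi : LocSemiConvex X C D)
    {m : ℕ} (hm : 1 ≤ m) {y : X} {p q : Fin m → X} (hstr : IsStrainer S C D δ y p q)
    (hlt : ∀ i, dist (p i) y < D) {U : Set X} (hU : IsOpen U) (hyU : y ∈ U)
    (hno : ∀ u ∈ U, u ∉ strainedPoints X S C D δ (m + 1)) :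
    ∃ r > 0, ∃ ε > 0, ∀ z ∈ ball y r, ∀ w ∈ ball y r,
      ε * dist z w ≤ dist (fun i => dist (p i) z) (fun i => dist (p i) w) := by
  obtain ⟨η, hη, hη'⟩ := aux_small_half hδ
  obtain ⟨η₂, hη₂, hη₂'⟩ := aux_small_zero hδ
  obtain ⟨ρ, hρ, hρ0⟩ : ∃ ρ : ℝ, (∀ i, ρ < dist (p i) y) ∧ 0 < ρ := by
    have h1 : ∀ᶠ ρ : ℝ in 𝓝[>] 0, ∀ i, ρ < dist (p i) y := by
      refine eventually_all.2 fun i => ?_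
      exact mem_nhdsWithin_of_mem_nhds (gt_mem_nhds (dist_pos.2 (hstr.1 i).1))
    exact (h1.and self_mem_nhdsWithin).exists
  have hev : ∀ᶠ u in 𝓝 y, IsStrainer S C D δ u p q ∧ u ∈ U ∧
      ∀ i, ρ < dist (p i) u ∧ dist (p i) u < D := by
    refine (aux_open hstr).and (Filter.Eventually.and (hU.mem_nhds hyU) (eventually_all.2 fun i => ?_))
    have hc : ContinuousAt (fun u => dist (p i) u) y := by fun_prop
    exact (hc.eventually (lt_mem_nhds (hρ i))).and (hc.eventually (gt_mem_nhds (hlt i)))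
  obtain ⟨r₁, hr₁, hball⟩ := Metric.eventually_nhds_iff.1 hev
  obtain ⟨r, hr, hrr, hra, hrb⟩ : ∃ r > 0, 3 * r ≤ r₁ ∧ (S + C + 1) * (2 * r) ≤ ρ * η / 2 ∧
      (S + C + 1) * (2 * r) ≤ ρ * η₂ := by
    have hp : 0 < S + C + 1 := by linarith
    refine ⟨min (r₁ / 3) (min (ρ * η / 4 / (S + C + 1)) (ρ * η₂ / 2 / (S + C + 1))),
      by positivity, ?_, ?_, ?_⟩
    · have := min_le_left (r₁ / 3) (min (ρ * η / 4 / (S + C + 1)) (ρ * η₂ / 2 / (S + C + 1)))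
      linarith
    · have := (min_le_right (r₁ / 3) (min (ρ * η / 4 / (S + C + 1))
        (ρ * η₂ / 2 / (S + C + 1)))).trans (min_le_left _ _)
      rw [le_div_iff₀ hp] at this
      nlinarith
    · have := (min_le_right (r₁ / 3) (min (ρ * η / 4 / (S + C + 1))
        (ρ * η₂ / 2 / (S + C + 1)))).trans (min_le_right _ _)
      rw [le_div_iff₀ hp] at this
      nlinarith
  refine ⟨r, hr, ρ * η / (4 * D), by positivity, fun z hz w hw => ?_⟩
  by_contra hcon
  push Not at hcon
  set ε := ρ * η / (4 * D) with hε
  have hε0 : 0 < ε := by positivity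
  have hDε : 2 * D * ε = ρ * η / 2 := by rw [hε]; field_simp; norm_num
  have hL : 0 < dist z w := by
    rcases (dist_nonneg (x := z) (y := w)).eq_or_lt with h | h
    · rw [← h, mul_zero] at hcon
      exact absurd hcon (not_lt.2 dist_nonneg)
    · exact h
  have hfi : ∀ i, |dist (p i) z - dist (p i) w| ≤ ε * dist z w := fun i => by
    have := dist_le_pi_dist (fun i => dist (p i) z) (fun i => dist (p i) w) i
    rw [Real.dist_eq] at this
    exact this.trans hcon.le
  rw [mem_ball] at hz hw
  have hL2 : dist z w < 2 * r := by
    have := dist_triangle_right z w y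
    linarith
  obtain ⟨γ, hγ, hγ0, hγ1⟩ := hgeo z w
  set L := dist z w with hLdef
  have hin : ∀ t ∈ Set.Icc (0:ℝ) 1, dist (γ t) y < r₁ := by
    intro t ht
    have h1 := hγ t ht 0 ⟨le_rfl, zero_le_one⟩
    rw [hγ0, hγ1, sub_zero, abs_of_nonneg ht.1] at h1
    have h2 := dist_triangle (γ t) z y
    have h3 : t * dist z w ≤ 1 * L := by
      rw [← hLdef]; gcongr; exact ht.2
    linarith
  obtain ⟨τ, hτ0, hτ1, hτ2⟩ : ∃ τ : ℝ, 0 < τ ∧ τ ≤ 1 / 2 ∧ S * τ < η₂ := by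
    have hS0 : 0 < S := by linarith
    refine ⟨min (1 / 2) (η₂ / (2 * S)), by positivity, min_le_left _ _, ?_⟩
    have := min_le_right (1 / 2) (η₂ / (2 * S))
    rw [le_div_iff₀ (by positivity)] at this
    nlinarith
  have hmem : (1 - τ) ∈ Set.Icc (0:ℝ) 1 := ⟨by linarith, by linarith⟩
  set u := γ (1 - τ) with hu
  obtain ⟨hus, huU, hub⟩ := hball (hin _ hmem)
  have duz : dist u z = (1 - τ) * L := by
    have h1 := hγ (1 - τ) hmem 0 ⟨le_rfl, zero_le_one⟩
    rwa [hγ0, hγ1, sub_zero, abs_of_nonneg hmem.1] at h1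
  have duw : dist u w = τ * L := by
    have h1 := hγ (1 - τ) hmem 1 ⟨zero_le_one, le_rfl⟩
    rw [hγ0, hγ1] at h1
    rw [h1, show (1 - τ - 1) = -τ by ring, abs_neg, abs_of_pos hτ0]
  have h1τ : 0 < 1 - τ := by linarith
  -- the basic estimate along the geodesic
  have hbasic : ∀ i, -(2 * D * ε * L) ≤ dist (p i) w ^ 2 - dist (p i) z ^ 2 ∧
      dist (p i) w ^ 2 - dist (p i) z ^ 2 ≤ 2 * D * ε * L := by
    intro i
    have hz' := ((hball (by linarith : dist z y < r₁)).2.2 i).2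
    have hw' := ((hball (by linarith : dist w y < r₁)).2.2 i).2
    rw [← abs_le, sq_sub_sq, abs_mul, abs_of_nonneg (by positivity)]
    calc (dist (p i) w + dist (p i) z) * |dist (p i) w - dist (p i) z|
        ≤ (2 * D) * (ε * L) := by
          gcongr
          · linarith
          · rw [abs_sub_comm]; exact hfi i
      _ = _ := by ring
  have hlo : ∀ i, τ * dist (p i) z ^ 2 + (1 - τ) * dist (p i) w ^ 2
      - S * τ * (1 - τ) * L ^ 2 ≤ dist (p i) u ^ 2 := by
    intro i
    have := hconc (p i) γ hγ (1 - τ) hmem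
    rw [hγ0, hγ1, show 1 - (1 - τ) = τ by ring] at this
    linarith
  have hhi : ∀ i, dist (p i) u ^ 2 ≤ τ * dist (p i) z ^ 2 + (1 - τ) * dist (p i) w ^ 2
      + C * τ * (1 - τ) * L ^ 2 := by
    intro i
    have := hsemi (p i) γ hγ (fun t ht => ((hball (hin t ht)).2.2 i).2) (1 - τ) hmem
    rw [hγ0, hγ1, show 1 - (1 - τ) = τ by ring] at this
    linarith
  set K := 2 * D * ε + (S + C + 1) * L with hK
  have hKlt : K < 2 * ρ * η := by
    have : (S + C + 1) * L ≤ (S + C + 1) * (2 * r) := by gcongr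
    have : 0 < ρ * η := by positivity
    rw [hK]; linarith
  have hfin : ∀ i (b : X) (θ : ℝ), 0 < θ → dist u b = θ * L →
      |dist (p i) u ^ 2 + (θ * L) ^ 2 - dist (p i) b ^ 2| ≤ θ * L * K →
      |compAngle (p i) u b - Real.pi / 2| < δ := by
    intro i b θ hθ hub' hnum
    apply hη'
    have ha := (hub i).1
    have ha0 : 0 < dist (p i) u := hρ0.trans ha
    rw [dist_comm u (p i), hub', abs_div,
      abs_of_pos (by positivity : 0 < 2 * dist (p i) u * (θ * L)), div_lt_iff₀ (by positivity)]
    refine lt_of_le_of_lt hnum ?_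
    calc θ * L * K < θ * L * (2 * ρ * η) := by gcongr
      _ ≤ θ * L * (2 * dist (p i) u * η) := by gcongr
      _ = _ := by ring
  have hSC : 0 ≤ τ * (1 - τ) * L ^ 2 := by positivity
  have hang1 : ∀ i, |compAngle (p i) u z - Real.pi / 2| < δ := by
    intro i
    refine hfin i z (1 - τ) h1τ duz ?_
    obtain ⟨b1, b2⟩ := hbasic i
    have l1 := hlo i
    have l2 := hhi i
    have m1 := mul_le_mul_of_nonneg_left b1 h1τ.le
    have m2 := mul_le_mul_of_nonneg_left b2 h1τ.le
    have n1 : S * (τ * (1 - τ) * L ^ 2) ≤ S * ((1 - τ) * L ^ 2) := by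
      gcongr
      exact mul_le_of_le_one_left h1τ.le (by linarith)
    have n2 : C * (τ * (1 - τ) * L ^ 2) ≤ C * ((1 - τ) * L ^ 2) := by
      gcongr
      exact mul_le_of_le_one_left h1τ.le (by linarith)
    have n3 : (1 - τ) ^ 2 * L ^ 2 ≤ (1 - τ) * L ^ 2 := by
      gcongr
      exact pow_le_of_le_one h1τ.le (by linarith) two_ne_zero
    have n4 : 0 ≤ (1 - τ) ^ 2 * L ^ 2 := by positivity
    have n5 : 0 ≤ S * ((1 - τ) * L ^ 2) := by positivity
    have n6 : 0 ≤ C * ((1 - τ) * L ^ 2) := by positivity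
    have n7 : 0 ≤ (1 - τ) * L ^ 2 := by positivity
    rw [hK, abs_le]
    constructor <;> linarith
  have hang2 : ∀ i, |compAngle (p i) u w - Real.pi / 2| < δ := by
    intro i
    refine hfin i w τ hτ0 duw ?_
    obtain ⟨b1, b2⟩ := hbasic i
    have l1 := hlo i
    have l2 := hhi i
    have m1 := mul_le_mul_of_nonneg_left b1 hτ0.le
    have m2 := mul_le_mul_of_nonneg_left b2 hτ0.le
    have n1 : S * (τ * (1 - τ) * L ^ 2) ≤ S * (τ * L ^ 2) := by
      gcongr
      exact mul_le_of_le_one_right hτ0.le (by linarith)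
    have n2 : C * (τ * (1 - τ) * L ^ 2) ≤ C * (τ * L ^ 2) := by
      gcongr
      exact mul_le_of_le_one_right hτ0.le (by linarith)
    have n3 : τ ^ 2 * L ^ 2 ≤ τ * L ^ 2 := by
      gcongr
      exact pow_le_of_le_one hτ0.le (by linarith) two_ne_zero
    have n4 : 0 ≤ τ ^ 2 * L ^ 2 := by positivity
    have n5 : 0 ≤ S * (τ * L ^ 2) := by positivity
    have n6 : 0 ≤ C * (τ * L ^ 2) := by positivity
    have n7 : 0 ≤ τ * L ^ 2 := by positivity
    rw [hK, abs_le]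
    constructor <;> linarith
  have hnew : IsOneStrainer S δ u z w := by
    refine ⟨?_, ?_, ?_, ?_⟩
    · rw [ne_comm, ← dist_pos, duz]; positivity
    · rw [ne_comm, ← dist_pos, duw]; positivity
    · unfold compAngle
      rw [duz, duw, ← hLdef, show (((1 - τ) * L) ^ 2 + (τ * L) ^ 2 - L ^ 2) /
        (2 * ((1 - τ) * L) * (τ * L)) = -1 by field_simp; ring, Real.arccos_neg_one]
      linarith
    · apply hη₂'
      rw [dist_comm w u, dist_comm z u, duz, duw,
        show S * (τ * L) / (2 * ((1 - τ) * L)) = S * τ / (2 * (1 - τ)) by field_simp,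
        abs_of_nonneg (by positivity)]
      refine lt_of_le_of_lt ?_ hτ2
      exact div_le_self (by positivity) (by linarith)
  have hclose : ∀ i, Real.arccos (1 - (S + C) * dist z u / (2 * dist (p i) u)) < δ := by
    intro i
    apply hη₂'
    have ha := (hub i).1
    have ha0 : 0 < dist (p i) u := hρ0.trans ha
    rw [dist_comm z u, duz, abs_of_nonneg (by positivity), div_lt_iff₀ (by positivity)]
    have k1 : (S + C) * ((1 - τ) * L) ≤ (S + C + 1) * (1 * (2 * r)) :=
      mul_le_mul (by linarith) (mul_le_mul (by linarith) hL2.le hL.le (by norm_num))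
        (by positivity) (by linarith)
    have k2 : ρ * η₂ < dist (p i) u * η₂ := by gcongr
    have k3 : 0 < dist (p i) u * η₂ := by positivity
    linarith
  refine hno u huU ⟨Fin.snoc (α := fun _ => X) p z, Fin.snoc (α := fun _ => X) q w, ?_, ?_, ?_⟩
  · intro j
    refine Fin.lastCases ?_ (fun i => ?_) j
    · simpa using hnew
    · simpa using hus.1 i
  · intro j
    refine Fin.lastCases ?_ (fun i => ?_) j
    · intro h; simp at h; omega
    · intro h; simpa using hus.2.1 i (by simpa using h)
  · intro i j
    refine Fin.lastCases ?_ (fun j' => ?_) j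
    · refine Fin.lastCases ?_ (fun i' => ?_) i
      · intro h; exact absurd h (lt_irrefl _)
      · intro _
        simpa using ⟨hclose i', hang1 i', hang2 i'⟩
    · refine Fin.lastCases ?_ (fun i' => ?_) i
      · intro h; exact absurd h (not_lt.2 (Fin.castSucc_lt_last j').le)
      · intro h
        simpa using hus.2.2 i' j' (by simpa using h)

/-! ### Lower bound: the image of the strainer map has interior -/

lemma aux_dir {S C D δ : ℝ} (hS : 1 ≤ S) (hC : 0 ≤ C) (h0 : 0 < δ) (h1 : δ < 1 / 4)
    (hconc : SConcave X S) (hsemi : LocSemiConvex X C D)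
    {m : ℕ} {u : X} {p q : Fin m → X} (hstr : IsStrainer S C D δ u p q)
    (i : Fin m) (b : X) (hb : b = p i ∨ b = q i)
    {γ : ℝ → X} (hγ : IsConstSpeedGeodesic γ) (hγ0 : γ 0 = u) (hγ1 : γ 1 = b) {t : ℝ}
    (ht0 : 0 ≤ t) (ht1 : t ≤ 1) (j : Fin m) (hji : j < i) :
    dist (p j) u - 4 * δ * (t * dist b u) ≤ dist (p j) (γ t) ∧
      ((j : ℕ) ≠ 0 → dist (p j) (γ t) ≤ dist (p j) u + 4 * δ * (t * dist b u)) := by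
  have h1' : δ < 1 := by linarith
  obtain ⟨pj, -, -, -⟩ := aux_one h0 h1' (hstr.1 j)
  obtain ⟨pi, qi, -, hqp⟩ := aux_one h0 h1' (hstr.1 i)
  obtain ⟨c1, c2, c3⟩ := hstr.2.2 j i hji
  have r1 := aux_ratio h0 h1' pj c1
  have hbu : 0 < dist b u := by rcases hb with rfl | rfl <;> assumption
  have hle : dist b u ≤ dist (p i) u := by
    rcases hb with rfl | rfl
    · exact le_rfl
    · have : dist (q i) u ≤ S * dist (q i) u := le_mul_of_one_le_left dist_nonneg hS
      nlinarith
  have r2 : (S + C) * dist b u ≤ 2 * dist (p j) u * δ := by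
    refine le_trans ?_ r1
    gcongr
  have ho : |dist (p j) u ^ 2 + dist b u ^ 2 - dist (p j) b ^ 2| ≤
      2 * dist (p j) u * dist b u * δ := by
    rcases hb with rfl | rfl
    · exact aux_orth_s8 h0 h1' pj hbu c2
    · exact aux_orth_s8 h0 h1' pj hbu c3
  have r3 : 0 ≤ C * dist b u := by positivity
  have r4 : dist b u ≤ S * dist b u := le_mul_of_one_le_left dist_nonneg hS
  refine ⟨aux_orth_lower hconc h0 ho (by linarith) hγ hγ0 hγ1 ht0 ht1 hS, fun hj => ?_⟩
  refine aux_orth_upper hsemi h0 hC ho (by linarith) ?_ hγ hγ0 hγ1 ht0 ht1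
  -- the distance bound
  let i0 : Fin m := ⟨0, lt_of_le_of_lt (Nat.zero_le _) j.2⟩
  have hi0 : i0 < j := by
    rw [Fin.lt_def]; exact Nat.pos_of_ne_zero hj
  obtain ⟨p0, -, -, -⟩ := aux_one h0 h1' (hstr.1 i0)
  have hD0 := hstr.2.1 i0 rfl
  have s1 := aux_ratio h0 h1' p0 (hstr.2.2 i0 j hi0).1
  have s2 : 0 ≤ C * dist (p j) u := by positivity
  have s3 : dist (p j) u ≤ S * dist (p j) u := le_mul_of_one_le_left dist_nonneg hS
  have s4 : dist (p i0) u * δ ≤ dist (p i0) u * (1 / 4) := by gcongr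
  have s5 : dist (p j) u * δ ≤ dist (p j) u * (1 / 4) := by gcongr
  linarith

lemma aux_pt {γ : ℝ → X} (hγ : IsConstSpeedGeodesic γ) {u b : X} (hγ0 : γ 0 = u)
    (hγ1 : γ 1 = b) (hb : 0 < dist b u) {κ : ℝ} (hκ : 0 < κ) :
    ∃ t : ℝ, 0 ≤ t ∧ t ≤ 1 ∧ 0 < t * dist b u ∧ t * dist b u ≤ κ ∧
      dist u (γ t) = t * dist b u ∧ dist b (γ t) = dist b u - t * dist b u := by
  have ht : min 1 (κ / dist b u) ∈ Set.Icc (0:ℝ) 1 := ⟨by positivity, min_le_left _ _⟩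
  refine ⟨min 1 (κ / dist b u), ht.1, ht.2, by positivity, ?_, ?_, ?_⟩
  · calc _ ≤ (κ / dist b u) * dist b u := by gcongr; exact min_le_right _ _
      _ = κ := by field_simp
  · have := hγ 0 ⟨le_rfl, zero_le_one⟩ _ ht
    rw [zero_sub, abs_neg, abs_of_nonneg ht.1, hγ0, hγ1, dist_comm u b] at this
    exact this
  · have := hγ 1 ⟨zero_le_one, le_rfl⟩ _ ht
    rw [abs_of_nonneg (sub_nonneg.2 ht.2), hγ0, hγ1, dist_comm u b] at this
    rw [this]; ring

/-- moving upwards in the `i`-th coordinate. -/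
lemma aux_up {S C D δ : ℝ} (hS : 1 ≤ S) (hC : 0 ≤ C) (h0 : 0 < δ) (h1 : δ < 1 / 4)
    (hgeo : IsGeodesicSpace X) (hconc : SConcave X S) (hsemi : LocSemiConvex X C D)
    {m : ℕ} {u : X} {p q : Fin m → X} (hstr : IsStrainer S C D δ u p q)
    (i : Fin m) {κ : ℝ} (hκ : 0 < κ) :
    ∃ u' : X, 0 < dist u u' ∧ dist u u' ≤ κ ∧
      dist (p i) u + (1 - 3 * δ) * dist u u' ≤ dist (p i) u' ∧
      ∀ j < i, dist (p j) u - 4 * δ * dist u u' ≤ dist (p j) u' ∧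
        ((j : ℕ) ≠ 0 → dist (p j) u' ≤ dist (p j) u + 4 * δ * dist u u') := by
  obtain ⟨pi, qi, -, hqp⟩ := aux_one h0 (by linarith) (hstr.1 i)
  obtain ⟨γ, hγ, hγ0, hγ1⟩ := hgeo u (q i)
  obtain ⟨t, ht0, ht1, hs0, hs1, hd, -⟩ := aux_pt hγ hγ0 hγ1 qi
    (show 0 < min κ (2 * dist (p i) u * δ) by positivity)
  refine ⟨γ t, by rw [hd]; exact hs0, by rw [hd]; exact hs1.trans (min_le_left _ _), ?_,
    fun j hj => ?_⟩
  · rw [hd]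
    exact aux_toward_q hconc h0 h1 (hstr.1 i) hγ hγ0 hγ1 ht0 ht1
      (hs1.trans (min_le_right _ _)) hS
  · rw [hd]
    exact aux_dir hS hC h0 h1 hconc hsemi hstr i (q i) (Or.inr rfl) hγ hγ0 hγ1 ht0 ht1 j hj

/-- moving the `i`-th coordinate towards a prescribed value. -/
lemma aux_move {S C D δ : ℝ} (hS : 1 ≤ S) (hC : 0 ≤ C) (h0 : 0 < δ) (h1 : δ < 1 / 4)
    (hgeo : IsGeodesicSpace X) (hconc : SConcave X S) (hsemi : LocSemiConvex X C D)
    {m : ℕ} {u : X} {p q : Fin m → X} (hstr : IsStrainer S C D δ u p q)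
    (i : Fin m) {v : ℝ} (hv : dist (p i) u ≠ v) :
    ∃ u' : X, 0 < dist u u' ∧
      |dist (p i) u' - v| ≤ |dist (p i) u - v| - (1 - 3 * δ) * dist u u' ∧
      ∀ j < i, dist (p j) u - 4 * δ * dist u u' ≤ dist (p j) u' ∧
        ((j : ℕ) ≠ 0 → dist (p j) u' ≤ dist (p j) u + 4 * δ * dist u u') := by
  rcases lt_or_gt_of_ne hv with hlt | hgt
  · obtain ⟨u', a, b, c, d⟩ := aux_up hS hC h0 h1 hgeo hconc hsemi hstr i (sub_pos.2 hlt)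
    refine ⟨u', a, ?_, d⟩
    have := dist_triangle (p i) u u'
    rw [abs_of_nonpos (by linarith), abs_of_neg (by linarith)]
    linarith
  · obtain ⟨pi, qi, -, hqp⟩ := aux_one h0 (by linarith) (hstr.1 i)
    obtain ⟨γ, hγ, hγ0, hγ1⟩ := hgeo u (p i)
    obtain ⟨t, ht0, ht1, hs0, hs1, hd, hd'⟩ := aux_pt hγ hγ0 hγ1 pi (sub_pos.2 hgt)
    refine ⟨γ t, by rw [hd]; exact hs0, ?_, fun j hj => ?_⟩
    · rw [hd, hd', abs_of_nonneg (by linarith), abs_of_pos (by linarith)]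
      have : 0 ≤ δ * (t * dist (p i) u) := by positivity
      linarith
    · rw [hd]
      exact aux_dir hS hC h0 h1 hconc hsemi hstr i (p i) (Or.inl rfl) hγ hγ0 hγ1 ht0 ht1 j hj

set_option maxHeartbeats 1000000 in
lemma aux_A [CompleteSpace X] {S C D δ : ℝ} (hS : 1 ≤ S) (hC : 0 ≤ C)
    (hgeo : IsGeodesicSpace X) (hconc : SConcave X S) (hsemi : LocSemiConvex X C D)
    {m : ℕ} (hm : 1 ≤ m) (h0 : 0 < δ) (hδ : 128 * m * δ ≤ (1 / (4 * m) : ℝ) ^ m)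
    {y : X} {p q : Fin m → X} (hstr : IsStrainer S C D δ y p q) {r : ℝ} (hr : 0 < r) :
    (interior ((fun u i => dist (p i) u : X → Fin m → ℝ) '' ball y r)).Nonempty := by
  have hm1 : (1:ℝ) ≤ m := by exact_mod_cast hm
  have hm0 : (0:ℝ) < m := by linarith
  obtain ⟨ω, hω⟩ : ∃ ω : ℝ, ω = (1 / (4 * m) : ℝ) ^ m := ⟨_, rfl⟩
  rw [← hω] at hδ
  have hbase0 : 0 < (1 / (4 * m) : ℝ) := by positivity
  have hbase1 : (1 / (4 * m) : ℝ) ≤ 1 := by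
    rw [div_le_one (by positivity)]; linarith
  have hω0 : 0 < ω := by rw [hω]; positivity
  have hω1 : ω ≤ 1 := by rw [hω]; exact pow_le_one₀ hbase0.le hbase1
  have hmδ : 0 < m * δ := by positivity
  have hδm : δ ≤ m * δ := le_mul_of_one_le_left h0.le hm1
  have h1 : δ < 1 / 12 := by nlinarith
  obtain ⟨i0, hi0⟩ : ∃ i0 : Fin m, i0 = ⟨0, hm⟩ := ⟨_, rfl⟩
  have hi0' : ∀ i : Fin m, i ≠ i0 → (i : ℕ) ≠ 0 := by
    intro i hi h; apply hi; rw [hi0]; ext; exact h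
  have hi0lt : ∀ i : Fin m, i ≠ i0 → i0 < i := by
    intro i hi; rw [hi0, Fin.lt_def]; exact Nat.pos_of_ne_zero (hi0' i hi)
  obtain ⟨wt, hwt⟩ : ∃ wt : Fin m → ℝ,
      wt = fun i => if i = i0 then 0 else (1 / (4 * m) : ℝ) ^ (i : ℕ) := ⟨_, rfl⟩
  have hwt0 : wt i0 = 0 := by simp [hwt]
  have hwtn : ∀ i, i ≠ i0 → wt i = (1 / (4 * m) : ℝ) ^ (i : ℕ) := fun i hi => by simp [hwt, hi]
  have hw0 : ∀ i, 0 ≤ wt i := by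
    intro i
    by_cases hi : i = i0
    · rw [hi, hwt0]
    · rw [hwtn i hi]; positivity
  have hw1 : ∀ i, wt i ≤ 1 := by
    intro i
    by_cases hi : i = i0
    · rw [hi, hwt0]; exact zero_le_one
    · rw [hwtn i hi]; exact pow_le_one₀ hbase0.le hbase1
  have hwω : ∀ i, i ≠ i0 → ω ≤ wt i := by
    intro i hi
    rw [hwtn i hi, hω]
    exact pow_le_pow_of_le_one hbase0.le hbase1 i.2.le
  have hwlt : ∀ i j, i ≠ i0 → i < j → wt j ≤ wt i * (1 / (4 * m)) := by
    intro i j hi hij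
    have hj : j ≠ i0 := by
      rintro rfl; exact absurd (hi0lt i hi) (not_lt.2 hij.le)
    rw [hwtn i hi, hwtn j hj, ← pow_succ]
    exact pow_le_pow_of_le_one hbase0.le hbase1 hij
  -- potentials
  let f : X → Fin m → ℝ := fun u i => dist (p i) u
  have hf1 : ∀ u u' i, |f u' i - f u i| ≤ dist u u' := by
    intro u u' i
    have := abs_dist_sub_le u' u (p i)
    show |dist (p i) u' - dist (p i) u| ≤ _
    rw [dist_comm (p i) u', dist_comm (p i) u, dist_comm u u']
    exact this
  let Φ : (Fin m → ℝ) → X → ℝ := fun v u => ∑ i, wt i * |f u i - v i|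
  have hΦ0 : ∀ v u, 0 ≤ Φ v u := fun v u =>
    Finset.sum_nonneg fun i _ => mul_nonneg (hw0 i) (abs_nonneg _)
  have hΦc : ∀ v, Continuous (Φ v) := by
    intro v
    refine continuous_finsetSum _ fun i _ => ?_
    show Continuous fun u => wt i * |dist (p i) u - v i|
    fun_prop
  obtain ⟨c, hc⟩ : ∃ c : ℝ, c = ω / 4 := ⟨_, rfl⟩
  have hc0 : 0 < c := by rw [hc]; positivity
  -- neighbourhood on which the strainer works
  obtain ⟨r₁, hr₁, hball⟩ := Metric.eventually_nhds_iff.1 (aux_open hstr)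
  obtain ⟨R, hR⟩ : ∃ R : ℝ, R = min r r₁ := ⟨_, rfl⟩
  have hR0 : 0 < R := by rw [hR]; positivity
  -- moves
  have move : ∀ v u, dist u y < R → Φ v u ≠ 0 → ∃ u', 0 < dist u u' ∧
      Φ v u' ≤ Φ v u - c * dist u u' ∧ f u i0 - 4 * δ * dist u u' ≤ f u' i0 := by
    intro v u hu hne
    have hu' := hball (lt_of_lt_of_le hu (by rw [hR]; exact min_le_right _ _))
    obtain ⟨i, hi, hiv⟩ : ∃ i, i ≠ i0 ∧ f u i ≠ v i := by
      by_contra hcon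
      push Not at hcon
      apply hne
      refine Finset.sum_eq_zero fun i _ => ?_
      by_cases hi : i = i0
      · rw [hi, hwt0, zero_mul]
      · rw [hcon i hi, sub_self, abs_zero, mul_zero]
    obtain ⟨u', a, b, d⟩ := aux_move hS hC h0 (by linarith) hgeo hconc hsemi hu' i hiv
    refine ⟨u', a, ?_, (d i0 (hi0lt i hi)).1⟩
    set s := dist u u' with hs
    have hterm : ∀ j, wt j * |f u' j - v j| ≤ wt j * |f u j - v j| +
        ((wt i * (1 / (4 * m)) + 4 * δ) * s - if j = i then wt i * (1 - 3 * δ) * s else 0) := by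
      intro j
      have hpos1 : 0 ≤ wt i * (1 / (4 * m)) * s := by have := hw0 i; positivity
      have hpos2 : 0 ≤ δ * s := by positivity
      rcases lt_trichotomy j i with hji | rfl | hij
      · rw [if_neg hji.ne]
        by_cases hj : j = i0
        · rw [hj, hwt0]; nlinarith
        · obtain ⟨d1, d2⟩ := d j hji
          have d2 := d2 (hi0' j hj)
          have e1 : |f u' j - f u j| ≤ 4 * δ * s := by
            rw [abs_le]; constructor
            · show -_ ≤ dist (p j) u' - dist (p j) u; linarith
            · show dist (p j) u' - dist (p j) u ≤ _; linarith
          have e2 : |f u' j - v j| ≤ |f u' j - f u j| + |f u j - v j| := abs_sub_le _ _ _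
          have e3 : wt j * |f u' j - v j| ≤ wt j * (4 * δ * s + |f u j - v j|) :=
            mul_le_mul_of_nonneg_left (by linarith) (hw0 j)
          have e4 : wt j * (4 * δ * s) ≤ 1 * (4 * δ * s) :=
            mul_le_mul_of_nonneg_right (hw1 j) (by positivity)
          linarith
      · rw [if_pos rfl]
        have e3 : wt j * |f u' j - v j| ≤ wt j * (|f u j - v j| - (1 - 3 * δ) * s) :=
          mul_le_mul_of_nonneg_left b (hw0 j)
        linarith
      · rw [if_neg hij.ne']
        have e1 := hf1 u u' j
        have e2 : |f u' j - v j| ≤ |f u' j - f u j| + |f u j - v j| := abs_sub_le _ _ _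
        have e3 : wt j * |f u' j - v j| ≤ wt j * (s + |f u j - v j|) :=
          mul_le_mul_of_nonneg_left (by linarith) (hw0 j)
        have e4 : wt j * s ≤ wt i * (1 / (4 * m)) * s :=
          mul_le_mul_of_nonneg_right (hwlt i j hi hij) a.le
        linarith
    have hsum := Finset.sum_le_sum (fun j (_ : j ∈ Finset.univ) => hterm j)
    rw [Finset.sum_add_distrib, Finset.sum_sub_distrib, Finset.sum_const, Finset.card_univ,
      Fintype.card_fin, nsmul_eq_mul, Finset.sum_ite_eq' Finset.univ i,
      if_pos (Finset.mem_univ i)] at hsum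
    have e5 : (m : ℝ) * ((wt i * (1 / (4 * m)) + 4 * δ) * s) = (wt i / 4 + 4 * (m * δ)) * s := by
      field_simp
    rw [e5] at hsum
    have e6 : (wt i / 4 + 4 * (m * δ)) * s - wt i * (1 - 3 * δ) * s ≤ - (c * s) := by
      have hwi := hwω i hi
      have : (wt i / 4 + 4 * (m * δ)) - wt i * (1 - 3 * δ) ≤ - c := by
        have : wt i * δ ≤ wt i * (1 / 12) := mul_le_mul_of_nonneg_left h1.le (hw0 i)
        rw [hc]; linarith
      have := mul_le_mul_of_nonneg_right this a.le
      linarith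
    show ∑ j, wt j * |f u' j - v j| ≤ ∑ j, wt j * |f u j - v j| - c * s
    linarith
  have move0 : ∀ v u κ, dist u y < R → Φ v u = 0 → 0 < κ → ∃ u', 0 < dist u u' ∧
      dist u u' ≤ κ ∧ Φ v u' ≤ m * dist u u' ∧ f u i0 + (1 - 3 * δ) * dist u u' ≤ f u' i0 := by
    intro v u κ hu hz hκ
    have hu' := hball (lt_of_lt_of_le hu (by rw [hR]; exact min_le_right _ _))
    obtain ⟨u', a, b, d, -⟩ := aux_up hS hC h0 (by linarith) hgeo hconc hsemi hu' i0 hκ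
    refine ⟨u', a, b, ?_, d⟩
    have hterm : ∀ j, wt j * |f u' j - v j| ≤ wt j * |f u j - v j| + dist u u' := by
      intro j
      have e1 := hf1 u u' j
      have e2 : |f u' j - v j| ≤ |f u' j - f u j| + |f u j - v j| := abs_sub_le _ _ _
      have e3 : wt j * |f u' j - v j| ≤ wt j * (dist u u' + |f u j - v j|) :=
        mul_le_mul_of_nonneg_left (by linarith) (hw0 j)
      have e4 : wt j * dist u u' ≤ 1 * dist u u' :=
        mul_le_mul_of_nonneg_right (hw1 j) a.le
      linarith
    have hsum := Finset.sum_le_sum (fun j (_ : j ∈ Finset.univ) => hterm j)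
    rw [Finset.sum_add_distrib, Finset.sum_const, Finset.card_univ,
      Fintype.card_fin, nsmul_eq_mul] at hsum
    have hz' : ∑ j, wt j * |f u j - v j| = 0 := hz
    show ∑ j, wt j * |f u' j - v j| ≤ _
    linarith
  -- the open set of reachable values
  let O : Set (Fin m → ℝ) := {v | Φ v y < c * (v i0 - f y i0) ∧
    4 * m * (v i0 - f y i0) + Φ v y < c / 2 * R}
  have hcv : Continuous fun v : Fin m → ℝ => Φ v y := by
    refine continuous_finsetSum _ fun i _ => ?_
    fun_prop
  have hci : Continuous fun v : Fin m → ℝ => v i0 - f y i0 := by fun_prop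
  have hO : IsOpen O :=
    (isOpen_lt hcv (continuous_const.mul hci)).inter
      (isOpen_lt ((continuous_const.mul hci).add hcv) continuous_const)
  have hOne : O.Nonempty := by
    obtain ⟨κ, hκ⟩ : ∃ κ : ℝ, κ = c / 2 * R / (8 * m) := ⟨_, rfl⟩
    have hκ0 : 0 < κ := by rw [hκ]; positivity
    refine ⟨fun i => if i = i0 then f y i0 + κ else f y i, ?_⟩
    have hz : Φ (fun i => if i = i0 then f y i0 + κ else f y i) y = 0 := by
      refine Finset.sum_eq_zero fun i _ => ?_
      by_cases hi : i = i0
      · rw [hi, hwt0, zero_mul]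
      · simp [hi]
    constructor
    · rw [hz]; simp only [if_true]
      rw [add_sub_cancel_left]; positivity
    · rw [hz]; simp only [if_true]
      rw [add_sub_cancel_left, add_zero, hκ]
      have : 0 < c / 2 * R := by positivity
      rw [show 4 * (m:ℝ) * (c / 2 * R / (8 * m)) = c / 2 * R / 2 by field_simp; norm_num]
      linarith
  refine hOne.mono (interior_maximal ?_ hO)
  rintro v ⟨hv1, hv2⟩
  -- apply the Ekeland-type lemma
  have hfc : Continuous fun u => f u i0 := by
    show Continuous fun u => dist (p i0) u
    fun_prop
  have hGc : Continuous fun u => v i0 - f u i0 := continuous_const.sub hfc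
  have hc4m : c / 2 ≤ m := by rw [hc]; linarith
  obtain ⟨u, huA, huz, hud⟩ := aux_ekeland {u | Φ v u ≤ c * (v i0 - f u i0)}
    (isClosed_le (hΦc v) (continuous_const.mul hGc))
    (fun u => 4 * m * (v i0 - f u i0) + Φ v u)
    ((continuous_const.mul hGc).add (hΦc v)) (c / 2) (by positivity) y hv1.le
    (by
      intro u hu
      have hG : 0 ≤ v i0 - f u i0 := by
        have h2 : 0 ≤ c * (v i0 - f u i0) := (hΦ0 v u).trans hu
        exact nonneg_of_mul_nonneg_right h2 hc0
      have := hΦ0 v u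
      positivity)
    (by
      intro u hu hpos hdist
      have huR : dist u y < R := by
        rw [dist_comm]
        exact lt_of_mul_lt_mul_left (hdist.trans_lt hv2) (by positivity)
      have hu : Φ v u ≤ c * (v i0 - f u i0) := hu
      by_cases hz : Φ v u = 0
      · have hG : 0 < v i0 - f u i0 := by
          rw [hz, add_zero] at hpos
          exact pos_of_mul_pos_right hpos (by positivity)
        obtain ⟨u', a, b, d, e⟩ := move0 v u (c * (v i0 - f u i0) / (m + c)) huR hz
          (by positivity)
        rw [le_div_iff₀ (by positivity)] at b
        refine ⟨u', ?_, ?_, ?_⟩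
        · have hl := (abs_le.1 (hf1 u u' i0)).2
          have : c * (v i0 - f u i0 - dist u u') ≤ c * (v i0 - f u' i0) := 
            mul_le_mul_of_nonneg_left (by linarith) hc0.le
          show Φ v u' ≤ _
          linarith
        · rintro rfl; rw [dist_self] at a; exact lt_irrefl _ a
        · show 4 * m * (v i0 - f u' i0) + Φ v u' + c / 2 * dist u u' ≤
            4 * m * (v i0 - f u i0) + Φ v u
          rw [hz]
          have k1 : (4 * m : ℝ) * (v i0 - f u' i0) ≤
              4 * m * (v i0 - f u i0 - (1 - 3 * δ) * dist u u') := 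
            mul_le_mul_of_nonneg_left (by linarith) (by positivity)
          have k2 : c / 2 * dist u u' ≤ m * dist u u' := by gcongr
          have k3 : (m * dist u u') * δ ≤ (m * dist u u') * (1 / 12) := by gcongr
          have k4 : 0 ≤ m * dist u u' := by positivity
          linarith
      · obtain ⟨u', a, b, d⟩ := move v u huR hz
        refine ⟨u', ?_, ?_, ?_⟩
        · have hl := (abs_le.1 (hf1 u u' i0)).2
          have : c * (v i0 - f u i0 - dist u u') ≤ c * (v i0 - f u' i0) := 
            mul_le_mul_of_nonneg_left (by linarith) hc0.le
          show Φ v u' ≤ _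
          linarith
        · rintro rfl; rw [dist_self] at a; exact lt_irrefl _ a
        · show 4 * m * (v i0 - f u' i0) + Φ v u' + c / 2 * dist u u' ≤
            4 * m * (v i0 - f u i0) + Φ v u
          have k1 : (4 * m : ℝ) * (v i0 - f u' i0) ≤
              4 * m * (v i0 - f u i0 + 4 * δ * dist u u') := 
            mul_le_mul_of_nonneg_left (by linarith) (by positivity)
          have k2 : (16 * m * δ) * dist u u' ≤ c / 2 * dist u u' := by
            gcongr
            rw [hc]; linarith
          linarith)
  have huA : Φ v u ≤ c * (v i0 - f u i0) := huA
  have hG : 0 ≤ v i0 - f u i0 := by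
    have h2 : 0 ≤ c * (v i0 - f u i0) := (hΦ0 v u).trans huA
    exact nonneg_of_mul_nonneg_right h2 hc0
  have hmG : 0 ≤ 4 * m * (v i0 - f u i0) := by positivity
  have hΦz : Φ v u = 0 := le_antisymm (by linarith) (hΦ0 v u)
  have hGz : v i0 - f u i0 = 0 := by
    rw [hΦz, add_zero] at huz
    rcases mul_eq_zero.1 huz with h | h
    · exact absurd h (by positivity)
    · exact h
  refine ⟨u, ?_, ?_⟩
  · rw [mem_ball, dist_comm]
    refine lt_of_lt_of_le (lt_of_mul_lt_mul_left (hud.trans_lt hv2) (by positivity)) ?_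
    rw [hR]; exact min_le_left _ _
  · funext i
    show f u i = v i
    by_cases hi : i = i0
    · rw [hi]; linarith
    · have h2 := (Finset.sum_eq_zero_iff_of_nonneg
        (fun j _ => mul_nonneg (hw0 j) (abs_nonneg (f u j - v j)))).1 hΦz i (Finset.mem_univ i)
      rcases mul_eq_zero.1 h2 with h | h
      · exact absurd h (hω0.trans_le (hwω i hi)).ne'
      · linarith [abs_eq_zero.1 h]

/-- if the strainer number at `x` equals `m`, then every open
neighborhood of `x` has Hausdorff dimension `m`. -/
theorem stmt_8 {X : Type*} [MetricSpace X] [CompleteSpace X]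
    (S C D : ℝ) (hS : 1 ≤ S) (hC : 0 ≤ C) (hD : 0 < D)
    (hgeo : IsGeodesicSpace X) (hconc : SConcave X S)
    (hsemi : LocSemiConvex X C D) (hbus : BusemannConcave X)
    (x : X) (m : ℕ) (hm : 1 ≤ m)
    (hlow : ∀ δ : ℝ, 0 < δ → δ < strainerDelta m →
      ∀ U : Set X, IsOpen U → x ∈ U →
        ∃ y ∈ U, y ∈ strainedPoints X S C D δ m)
    (hupp : ∃ δ' : ℝ, 0 < δ' ∧ δ' < strainerDelta (m + 1) ∧
      ∃ U : Set X, IsOpen U ∧ x ∈ U ∧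
        ∀ y ∈ U, y ∉ strainedPoints X S C D δ' (m + 1)) :
    ∀ U : Set X, IsOpen U → x ∈ U → dimH U = m := by
  obtain ⟨δ', hδ'0, hδ'1, U', hU', hxU', hno⟩ := hupp
  have hm1 : (1:ℝ) ≤ m := by exact_mod_cast hm
  have hm0 : (0:ℝ) < m := by linarith
  have hsd : 0 < strainerDelta m := by unfold strainerDelta; positivity
  obtain ⟨δ, hδ⟩ : ∃ δ : ℝ, δ = min (min δ' (1 / 8)) (min (strainerDelta m / 2)
    ((1 / (4 * m) : ℝ) ^ m / (128 * m))) := ⟨_, rfl⟩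
  have hδ0 : 0 < δ := by rw [hδ]; positivity
  have hδa : δ ≤ δ' := by
    rw [hδ]; exact (min_le_left _ _).trans (min_le_left _ _)
  have hδb : δ ≤ 1 / 8 := by
    rw [hδ]; exact (min_le_left _ _).trans (min_le_right _ _)
  have hδc : δ < strainerDelta m := by
    have : δ ≤ strainerDelta m / 2 := by
      rw [hδ]; exact (min_le_right _ _).trans (min_le_left _ _)
    linarith
  have hδd : 128 * m * δ ≤ (1 / (4 * m) : ℝ) ^ m := by
    have : δ ≤ (1 / (4 * m) : ℝ) ^ m / (128 * m) := by
      rw [hδ]; exact (min_le_right _ _).trans (min_le_right _ _)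
    rw [le_div_iff₀ (by positivity)] at this
    linarith
  obtain ⟨y, hyU', p, q, hstr⟩ := hlow δ hδ0 hδc U' hU' hxU'
  have hlt : ∀ i, dist (p i) y < D := by
    intro i
    have hi0 : dist (p ⟨0, hm⟩) y < D := hstr.2.1 ⟨0, hm⟩ rfl
    by_cases hi : i = ⟨0, hm⟩
    · rw [hi]; exact hi0
    · have hi' : (⟨0, hm⟩ : Fin m) < i := by
        rw [Fin.lt_def]
        refine Nat.pos_of_ne_zero fun h => hi (Fin.ext h)
      have hp0 : 0 < dist (p ⟨0, hm⟩) y := dist_pos.2 (hstr.1 _).1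
      have h1 := aux_ratio hδ0 (by linarith) hp0 (hstr.2.2 _ i hi').1
      have h2 : 0 ≤ C * dist (p i) y := by positivity
      have h3 : dist (p i) y ≤ S * dist (p i) y := le_mul_of_one_le_left dist_nonneg hS
      have h4 : dist (p ⟨0, hm⟩) y * δ ≤ dist (p ⟨0, hm⟩) y * (1 / 8) := by gcongr
      linarith
  obtain ⟨r, hr, ε, hε, hbi⟩ := aux_B hS hC hD hδ'0 hgeo hconc hsemi hm
    (aux_mono hδa hstr) hlt hU' hyU' hno
  -- the dimension of the ball around `y`
  have hFlip : LipschitzWith 1 (fun u i => dist (p i) u : X → Fin m → ℝ) := by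
    refine LipschitzWith.of_dist_le_mul fun u u' => ?_
    rw [NNReal.coe_one, one_mul]
    refine (dist_pi_le_iff dist_nonneg).2 fun i => ?_
    exact dist_dist_dist_le_right _ _ _
  have hge : (m : ENNReal) ≤ dimH (ball y r) := by
    have h1 := Real.dimH_of_nonempty_interior
      (aux_A hS hC hgeo hconc hsemi hm hδ0 hδd hstr hr)
    rw [Module.finrank_fin_fun] at h1
    rw [← h1]
    exact hFlip.dimH_image_le _
  have hle : dimH (ball y r) ≤ m := by
    have hanti : AntilipschitzWith (Real.toNNReal ε⁻¹)
        (fun u : ball y r => (fun i => dist (p i) (u : X) : Fin m → ℝ)) := by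
      refine AntilipschitzWith.of_le_mul_dist fun u u' => ?_
      rw [Real.coe_toNNReal _ (by positivity)]
      have := hbi u u.2 u' u'.2
      rw [inv_mul_eq_div, le_div_iff₀ hε, mul_comm]
      exact this
    have h1 := hanti.le_dimH_image Set.univ
    have h2 : dimH (Set.univ : Set (ball y r)) = dimH (ball y r) := by
      have := (isometry_subtype_coe (s := ball y r)).dimH_image Set.univ
      rw [← this, Set.image_univ, Subtype.range_coe]
    rw [← h2]
    refine h1.trans ((dimH_mono (Set.subset_univ _)).trans ?_)
    rw [Real.dimH_univ_pi_fin]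
  intro U hU hxU
  refine le_antisymm ?_ ?_
  · have hsub : U ⊆ ⋃ n : ℕ, ball x n := by
      intro z _
      obtain ⟨n, hn⟩ := exists_nat_gt (dist z x)
      exact Set.mem_iUnion.2 ⟨n, hn⟩
    refine (dimH_mono hsub).trans ?_
    rw [dimH_iUnion]
    exact iSup_le fun n => (aux_transfer hgeo hbus y x r n hr).trans hle
  · obtain ⟨e, he, hsub⟩ := Metric.isOpen_iff.1 hU x hxU
    exact hge.trans ((aux_transfer hgeo hbus x y e r he).trans (dimH_mono hsub))
end
end
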